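/- arXiv:2208.10288 — 2 statements merged into one kernel-verified Lean document; each statement's English description precedes it below -/
import Mathlib

section
/- Let A ≥ 240. There exists a constant C > 0, depending only on A, with the following property. Let H be a real Hilbert space, let E ⊆ H be nonempty with diam E < ∞, and let G be a multiresolution family for E with inflation factor A. If S_{E,2}(G) := diam E + Σ_{Q ∈ G} β_E(Q)²·diam Q < ∞, then E is contained in a rectifiable curve Γ ⊆ H with H^1(Γ) ≤ C·S_{E,2}(G). -/
open Metric MeasureTheory Set Bornology
open scoped ENNReal NNReal Classical

universe u

noncomputable section

/-- The affine line through `a` with direction `v`. -/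
def lineThrough {X : Type u} [AddCommGroup X] [Module ℝ X] (a v : X) : Set X :=
  {y | ∃ t : ℝ, y = a + t • v}

/-- The Jones beta number of `E` in the window `Q`:
`β_E(Q) = inf_L sup_{x ∈ E ∩ Q} dist(x,L)/diam Q`, with value `0` if `E ∩ Q = ∅`. -/
def jonesBeta {X : Type u} [NormedAddCommGroup X] [NormedSpace ℝ X] (E Q : Set X) : ℝ :=
  if E ∩ Q = ∅ then 0
  else sInf {r : ℝ | ∃ a v : X, v ≠ 0 ∧
    r = sSup ((fun x => infDist x (lineThrough a v) / Metric.diam Q) '' (E ∩ Q))}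

/-- `net` encodes a partial multiresolution family for `E`: a nested family of
`2^{-k}`-separated subsets of `E`. -/
def IsPartialMultiresolution {X : Type u} [NormedAddCommGroup X]
    (E : Set X) (net : ℤ → Set X) : Prop :=
  (∀ k, net k ⊆ E) ∧ (∀ k, net k ⊆ net (k + 1)) ∧
    (∀ k : ℤ, ∀ x ∈ net k, ∀ y ∈ net k, x ≠ y → (2 : ℝ) ^ (-k) ≤ dist x y)

/-- `net` encodes a multiresolution family for `E`: a nested family of `2^{-k}`-nets for `E`. -/
def IsMultiresolution {X : Type u} [NormedAddCommGroup X]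
    (E : Set X) (net : ℤ → Set X) : Prop :=
  IsPartialMultiresolution E net ∧ ∀ k : ℤ, ∀ e ∈ E, ∃ x ∈ net k, dist e x ≤ (2 : ℝ) ^ (-k)

/-- The sum `Σ_{Q ∈ G} β_E(Q)^p · diam Q` over the (partial) multiresolution family
`G = {B(x, A·2^{-k}) : x ∈ net k, k ∈ ℤ}` with inflation factor `A`. -/
def betaSum {X : Type u} [NormedAddCommGroup X] [NormedSpace ℝ X]
    (E : Set X) (net : ℤ → Set X) (A p : ℝ) : ℝ≥0∞ :=
  ∑' (k : ℤ), ∑' (x : net k),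
    ENNReal.ofReal (jonesBeta E (closedBall (x : X) (A * (2 : ℝ) ^ (-k))) ^ p *
      Metric.diam (closedBall (x : X) (A * (2 : ℝ) ^ (-k))))

/-- `S_{E,p}(G) = diam E + Σ_{Q ∈ G} β_E(Q)^p · diam Q`. -/
def SEp {X : Type u} [NormedAddCommGroup X] [NormedSpace ℝ X]
    (E : Set X) (net : ℤ → Set X) (A p : ℝ) : ℝ≥0∞ :=
  ENNReal.ofReal (Metric.diam E) + betaSum E net A p

/-- `Γ` is a rectifiable curve: the image of a continuous map `[0,1] → X` with
finite one-dimensional Hausdorff measure. -/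
def IsRectifiableCurve {X : Type u} [NormedAddCommGroup X]
    [MeasurableSpace X] [BorelSpace X] (Γ : Set X) : Prop :=
  (∃ f : ℝ → X, ContinuousOn f (Set.Icc (0 : ℝ) 1) ∧ Γ = f '' Set.Icc (0 : ℝ) 1) ∧
    μH[1] Γ < ⊤

section Charts

variable {M : Type u} [MetricSpace M]

/-- `t` is a one-dimensional coordinate on `B`: it is `1`-Lipschitz there, and it determines
squared distances up to an additive error `h ^ 2`. -/
def NearIso (B : Set M) (t : M → ℝ) (h : ℝ) : Prop :=
  ∀ z ∈ B, ∀ w ∈ B, |t z - t w| ≤ dist z w ∧ dist z w ^ 2 ≤ (t z - t w) ^ 2 + h ^ 2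

theorem NearIso.mono {B B' : Set M} {t : M → ℝ} {h : ℝ} (ht : NearIso B t h) (hB : B' ⊆ B) :
    NearIso B' t h := fun z hz w hw => ht z (hB hz) w (hB hw)

theorem NearIso.dist_le {B : Set M} {t : M → ℝ} {h : ℝ} (ht : NearIso B t h) (h0 : 0 ≤ h)
    {z w : M} (hz : z ∈ B) (hw : w ∈ B) : dist z w ≤ |t z - t w| + h := by
  have := (ht z hz w hw).2
  have h1 := abs_nonneg (t z - t w)
  rw [← sq_abs (t z - t w)] at this
  exact abs_le_of_sq_le_sq' (by nlinarith) (by positivity) |>.2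

theorem NearIso.le_abs {B : Set M} {t : M → ℝ} {h s : ℝ} (ht : NearIso B t h) (h0 : 0 ≤ h)
    (hs : h ≤ s / 50) {z w : M} (hz : z ∈ B) (hw : w ∈ B) (hd : s ≤ dist z w) :
    s * (99 / 100) ≤ |t z - t w| := by
  have := (ht z hz w hw).2
  have hs0 : 0 ≤ s := by linarith
  have h1 : (s * (99 / 100)) ^ 2 ≤ (t z - t w) ^ 2 := by nlinarith
  rw [← abs_of_nonneg (show 0 ≤ s * (99 / 100) by positivity)]
  exact sq_le_sq.1 h1

/-- The sign of a product of coordinate differences does not depend on the coordinate. -/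
theorem NearIso.mul_pos_of_mul_pos {B : Set M} {t t' : M → ℝ} {h h' s : ℝ}
    (ht : NearIso B t h) (ht' : NearIso B t' h') (h0 : 0 ≤ h) (h0' : 0 ≤ h') (hs0 : 0 < s)
    (hs : h ≤ s / 50) (hs' : h' ≤ s / 50) {y z w : M} (hy : y ∈ B) (hz : z ∈ B) (hw : w ∈ B)
    (hyz : s ≤ dist z y) (hyw : s ≤ dist w y) (hpos : 0 < (t z - t y) * (t w - t y)) :
    0 < (t' z - t' y) * (t' w - t' y) := by
  have a1 := ht.le_abs h0 hs hz hy hyz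
  have a2 := ht.le_abs h0 hs hw hy hyw
  have b1 := ht z hz w hw
  have b2 := ht z hz y hy
  have b3 := ht w hw y hy
  have c1 := ht' z hz w hw
  have c2 := ht' z hz y hy
  have c3 := ht' w hw y hy
  have e1 : (s * (99 / 100)) * (s * (99 / 100)) ≤ (t z - t y) * (t w - t y) := by
    rw [← abs_of_pos hpos, abs_mul]
    exact mul_le_mul a1 a2 (by positivity) (by positivity)
  have sq : ∀ a b : ℝ, |a| ≤ b → a ^ 2 ≤ b ^ 2 := fun a b hab => by
    rw [← sq_abs]; exact pow_le_pow_left₀ (abs_nonneg _) hab 2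
  have q1 := sq _ _ b1.1
  have q2 := sq _ _ b2.1
  have q3 := sq _ _ b3.1
  have r1 := sq _ _ c1.1
  have r2 := sq _ _ c2.1
  have r3 := sq _ _ c3.1
  nlinarith [b1.2, b2.2, b3.2, c1.2, c2.2, c3.2, mul_pos hs0 hs0, mul_le_mul hs hs h0 (by linarith),
    mul_le_mul hs' hs' h0' (by linarith)]

/-- Two coordinates agree on a separated set up to orientation and a quadratic error. -/
theorem NearIso.compare {B : Set M} {t t' : M → ℝ} {h h' s : ℝ}
    (ht : NearIso B t h) (ht' : NearIso B t' h') (h0 : 0 ≤ h) (h0' : 0 ≤ h') (hs0 : 0 < s)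
    (hs : h ≤ s / 50) (hs' : h' ≤ s / 50) (hsep : ∀ z ∈ B, ∀ w ∈ B, z ≠ w → s ≤ dist z w)
    {y : M} (hy : y ∈ B) :
    ∃ σ : ℝ, (σ = 1 ∨ σ = -1) ∧
      ∀ z ∈ B, |(t z - t y) - σ * (t' z - t' y)| ≤ (h ^ 2 + h' ^ 2) / s := by
  have hη : 0 ≤ (h ^ 2 + h' ^ 2) / s := by positivity
  have key : ∀ σ : ℝ, (σ = 1 ∨ σ = -1) → ∀ z ∈ B, z ≠ y →
      0 < (t z - t y) * (σ * (t' z - t' y)) →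
      |(t z - t y) - σ * (t' z - t' y)| ≤ (h ^ 2 + h' ^ 2) / s := by
    intro σ hσ z hz hzy hpos
    have a1 := ht.le_abs h0 hs hz hy (hsep z hz y hy hzy)
    have b2 := ht z hz y hy
    have c2 := ht' z hz y hy
    have c1 := ht'.le_abs h0' hs' hz hy (hsep z hz y hy hzy)
    set a := t z - t y
    set c := t' z - t' y
    set d := dist z y
    have hσ2 : (σ * c) ^ 2 = c ^ 2 := by rcases hσ with rfl | rfl <;> ring
    have hσ3 : |σ * c| = |c| := by rcases hσ with rfl | rfl <;> simp
    have q1 : a ^ 2 ≤ d ^ 2 := by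
      rw [← sq_abs]; exact pow_le_pow_left₀ (abs_nonneg _) b2.1 2
    have q2 : c ^ 2 ≤ d ^ 2 := by
      rw [← sq_abs]; exact pow_le_pow_left₀ (abs_nonneg _) c2.1 2
    rw [← hσ3] at c1
    rw [← hσ2] at q2 c2
    set b := σ * c
    have hab : s ≤ |a + b| := by
      rcases pos_and_pos_or_neg_and_neg_of_mul_pos hpos with ⟨p, q⟩ | ⟨p, q⟩
      · rw [abs_of_pos p] at a1; rw [abs_of_pos q] at c1
        rw [abs_of_pos (by linarith)]; linarith
      · rw [abs_of_neg p] at a1; rw [abs_of_neg q] at c1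
        rw [abs_of_neg (by linarith)]; linarith
    rw [le_div_iff₀ hs0]
    calc |a - b| * s ≤ |a - b| * |a + b| := by gcongr
      _ = |a ^ 2 - b ^ 2| := by rw [← abs_mul]; ring_nf
      _ ≤ _ := by rw [abs_le]; constructor <;> nlinarith [b2.2, c2.2]
  have hne : ∀ {f : M → ℝ} {k : ℝ}, NearIso B f k → 0 ≤ k → k ≤ s / 50 → ∀ z ∈ B, z ≠ y →
      f z - f y ≠ 0 := by
    intro f k hf k0 ks z hz hzy h00
    have := hf.le_abs k0 ks hz hy (hsep z hz y hy hzy)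
    rw [h00, abs_zero] at this
    linarith
  by_cases hex : ∃ z ∈ B, z ≠ y
  · obtain ⟨z, hz, hzy⟩ := hex
    have n1 := hne ht h0 hs z hz hzy
    have n2 := hne ht' h0' hs' z hz hzy
    obtain ⟨σ, hσ, hp⟩ : ∃ σ : ℝ, (σ = 1 ∨ σ = -1) ∧ 0 < (t z - t y) * (σ * (t' z - t' y)) := by
      rcases lt_or_gt_of_ne (mul_ne_zero n1 n2) with h1 | h1
      · exact ⟨-1, Or.inr rfl, by linarith⟩
      · exact ⟨1, Or.inl rfl, by linarith⟩
    refine ⟨σ, hσ, fun w hw => ?_⟩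
    by_cases hwy : w = y
    · subst hwy; simpa using hη
    refine key σ hσ w hw hwy ?_
    have m1 := hne ht h0 hs w hw hwy
    have m2 := hne ht' h0' hs' w hw hwy
    have dz := hsep z hz y hy hzy
    have dw := hsep w hw y hy hwy
    rcases lt_or_gt_of_ne (mul_ne_zero n1 m1) with h1 | h1
    · have h2 : ¬ 0 < (t' z - t' y) * (t' w - t' y) := fun h2 => by
        have := ht'.mul_pos_of_mul_pos ht h0' h0 hs0 hs' hs hy hz hw dz dw h2
        linarith
      have h3 : (t' z - t' y) * (t' w - t' y) < 0 :=
        lt_of_le_of_ne (not_lt.1 h2) (mul_ne_zero n2 m2)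
      have h4 := mul_pos_of_neg_of_neg h1 h3
      have h5 : 0 < ((t z - t y) * (σ * (t' z - t' y))) * ((t w - t y) * (σ * (t' w - t' y))) := by
        have hσ2 : σ * σ = 1 := by rcases hσ with rfl | rfl <;> norm_num
        calc 0 < _ := h4
          _ = (σ * σ) * ((t z - t y) * (t w - t y) * ((t' z - t' y) * (t' w - t' y))) := by
            rw [hσ2, one_mul]
          _ = _ := by ring
      exact (pos_iff_pos_of_mul_pos h5).1 hp
    · have h3 := ht.mul_pos_of_mul_pos ht' h0 h0' hs0 hs hs' hy hz hw dz dw h1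
      have h4 := mul_pos h1 h3
      have h5 : 0 < ((t z - t y) * (σ * (t' z - t' y))) * ((t w - t y) * (σ * (t' w - t' y))) := by
        have hσ2 : σ * σ = 1 := by rcases hσ with rfl | rfl <;> norm_num
        calc 0 < _ := h4
          _ = (σ * σ) * ((t z - t y) * (t w - t y) * ((t' z - t' y) * (t' w - t' y))) := by
            rw [hσ2, one_mul]
          _ = _ := by ring
      exact (pos_iff_pos_of_mul_pos h5).1 hp
  · push Not at hex
    exact ⟨1, Or.inl rfl, fun z hz => by rw [hex z hz]; simpa using hη⟩

/-- A separated set carrying a coordinate with bounded range is finite, with a cardinality bound. -/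
theorem NearIso.card_le {B : Set M} {t : M → ℝ} {h s : ℝ} (ht : NearIso B t h) (h0 : 0 ≤ h)
    (hs0 : 0 < s) (hs : h ≤ s / 50) (hsep : ∀ z ∈ B, ∀ w ∈ B, z ≠ w → s ≤ dist z w)
    {y : M} (hy : y ∈ B) (hB : ∀ z ∈ B, dist z y ≤ 40 * s) :
    B.Finite ∧ B.ncard ≤ 103 := by
  have hmaps : ∀ z ∈ B, ⌊(t z - t y) / (s * (99 / 100))⌋ ∈ Set.Icc (-51 : ℤ) 51 := by
    intro z hz
    have h1 := abs_le.1 ((ht z hz y hy).1.trans (hB z hz))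
    have hp : 0 < s * (99 / 100) := by positivity
    rw [Set.mem_Icc, Int.le_floor, ← Int.lt_add_one_iff, Int.floor_lt, le_div_iff₀ hp,
      div_lt_iff₀ hp]
    push_cast
    constructor <;> nlinarith
  have hinj : Set.InjOn (fun z => ⌊(t z - t y) / (s * (99 / 100))⌋) B := by
    intro z hz w hw hzw
    by_contra hne
    have h1 := ht.le_abs h0 hs hz hw (hsep z hz w hw hne)
    have h2 := Int.abs_sub_lt_one_of_floor_eq_floor hzw
    have hp : 0 < s * (99 / 100) := by positivity
    rw [← sub_div, abs_div, abs_of_pos hp, div_lt_one hp] at h2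
    have : t z - t y - (t w - t y) = t z - t w := by ring
    rw [this] at h2
    linarith
  refine ⟨Set.Finite.of_injOn hmaps hinj (Set.finite_Icc _ _), ?_⟩
  refine (Set.ncard_le_ncard_of_injOn _ hmaps hinj (Set.finite_Icc _ _)).trans ?_
  rw [Set.ncard_eq_toFinset_card']
  simp

end Charts

section Regions

variable {M : Type u}

/-- The set of parameters whose distance to the coordinates of the centres in `C` is bounded by
the given radii, and which are closer to `t r.1` than to `t r.2` for all pairs `r ∈ R`. -/
def region (C : Set (M × ℝ)) (R : Set (M × M)) (t : M → ℝ) : Set ℝ :=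
  {τ | (∀ c ∈ C, |τ - t c.1| ≤ c.2) ∧ ∀ r ∈ R, |τ - t r.1| ≤ |τ - t r.2|}

theorem abs_sub_le_abs_sub_iff {τ a b : ℝ} :
    |τ - a| ≤ |τ - b| ↔ 2 * τ * (b - a) ≤ b ^ 2 - a ^ 2 := by
  rw [← sq_le_sq]
  constructor <;> intro h <;> nlinarith

theorem ordConnected_region (C : Set (M × ℝ)) (R : Set (M × M)) (t : M → ℝ) :
    (region C R t).OrdConnected := by
  constructor
  rintro a ⟨ha1, ha2⟩ b ⟨hb1, hb2⟩ τ ⟨h1, h2⟩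
  refine ⟨fun c hc => ?_, fun r hr => ?_⟩
  · have := abs_le.1 (ha1 c hc)
    have := abs_le.1 (hb1 c hc)
    exact abs_le.2 ⟨by linarith, by linarith⟩
  · have h3 := ha2 r hr
    have h4 := hb2 r hr
    rw [abs_sub_le_abs_sub_iff] at h3 h4 ⊢
    rcases le_total 0 (t r.2 - t r.1) with h | h <;> nlinarith

theorem measurableSet_region (C : Set (M × ℝ)) (R : Set (M × M)) (t : M → ℝ) :
    MeasurableSet (region C R t) := (ordConnected_region C R t).measurableSet

theorem region_inter (C C' : Set (M × ℝ)) (R R' : Set (M × M)) (t : M → ℝ) :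
    region C R t ∩ region C' R' t = region (C ∪ C') (R ∪ R') t := by
  ext τ
  simp only [region, Set.mem_inter_iff, Set.mem_ofPred_eq, Set.mem_union, or_imp, forall_and]
  tauto

theorem region_subset_Icc {C : Set (M × ℝ)} {R : Set (M × M)} {c : M × ℝ} (hc : c ∈ C)
    (t : M → ℝ) : region C R t ⊆ Set.Icc (t c.1 - c.2) (t c.1 + c.2) := by
  rintro τ ⟨h, -⟩
  have := abs_le.1 (h c hc)
  exact ⟨by linarith, by linarith⟩

theorem volume_region_ne_top {C : Set (M × ℝ)} {R : Set (M × M)} {c : M × ℝ} (hc : c ∈ C)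
    (t : M → ℝ) : volume (region C R t) ≠ ⊤ :=
  ((measure_mono (region_subset_Icc hc t)).trans_lt measure_Icc_lt_top).ne

theorem volume_region_le {C : Set (M × ℝ)} {R : Set (M × M)} {c : M × ℝ} (hc : c ∈ C)
    (h0 : 0 ≤ c.2) (t : M → ℝ) : volume.real (region C R t) ≤ 2 * c.2 := by
  refine (measureReal_mono (region_subset_Icc hc t) measure_Icc_lt_top.ne).trans ?_
  rw [Real.volume_real_Icc, max_eq_left] <;> linarith

theorem volume_region_affine (C : Set (M × ℝ)) (R : Set (M × M)) (t : M → ℝ) (c σ : ℝ)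
    (hσ : σ = 1 ∨ σ = -1) :
    volume.real (region C R fun z => c + σ * t z) = volume.real (region C R t) := by
  have h1 : region C R t = (fun τ => c + τ) ⁻¹' (region C R fun z => c + t z) := by
    ext τ; simp [region]
  rcases hσ with rfl | rfl
  · simp only [one_mul]
    rw [h1, Measure.real, Measure.real, measure_preimage_add]
  · have h2 : (region C R fun z => c + (-1) * t z) =
        (fun τ => c - τ) ⁻¹' (region C R t) := by
      ext τ
      have : ∀ z, |c - τ - t z| = |τ - (c + (-1) * t z)| := fun z => by
        rw [← abs_neg]; ring_nf
      simp only [region, Set.mem_ofPred_eq, Set.mem_preimage, this]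
    rw [h2, Measure.real, Measure.real]
    congr 1
    have h3 := (Measure.measurePreserving_sub_left (volume : Measure ℝ) c).measure_preimage
      (measurableSet_region C R t).nullMeasurableSet
    exact h3

theorem volume_region_le_of_abs_sub_le {C : Set (M × ℝ)} {R : Set (M × M)} {c : M × ℝ} (hc : c ∈ C)
    {t t' : M → ℝ} {η : ℝ} (hη : 0 ≤ η) (hC : ∀ c ∈ C, |t c.1 - t' c.1| ≤ η)
    (hR : ∀ r ∈ R, r.1 ≠ r.2 → |t r.1 - t' r.1| ≤ η ∧ |t r.2 - t' r.2| ≤ η ∧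
      2 * η < |t r.1 - t r.2|) :
    volume.real (region C R t) ≤ volume.real (region C R t') + 2 * η := by
  set S := region C R t with hS
  rcases S.eq_empty_or_nonempty with h0 | hne
  · rw [h0]; simp only [measureReal_empty]; positivity
  have hbdd : Bornology.IsBounded S := (Metric.isBounded_Icc _ _).subset (region_subset_Icc hc t)
  have hlo := hbdd.bddBelow
  have hhi := hbdd.bddAbove
  have hsub : S ⊆ Set.Icc (sInf S) (sSup S) := fun τ hτ => ⟨csInf_le hlo hτ, le_csSup hhi hτ⟩
  have hsub' : Set.Ioo (sInf S + η) (sSup S - η) ⊆ region C R t' := by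
    rintro τ ⟨h1, h2⟩
    obtain ⟨a, ha, ha'⟩ := exists_lt_of_csInf_lt hne (show sInf S < τ - η by linarith)
    obtain ⟨b, hb, hb'⟩ := exists_lt_of_lt_csSup hne (show τ + η < sSup S by linarith)
    have hm : τ - η ∈ S := (ordConnected_region C R t).out ha hb ⟨ha'.le, by linarith⟩
    have hp : τ + η ∈ S := (ordConnected_region C R t).out ha hb ⟨by linarith, hb'.le⟩
    refine ⟨fun c hc => ?_, fun r hr => ?_⟩
    · have e1 := abs_le.1 (hm.1 c hc)
      have e2 := abs_le.1 (hp.1 c hc)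
      have e3 := abs_le.1 (hC c hc)
      exact abs_le.2 ⟨by linarith, by linarith⟩
    · by_cases hrr : r.1 = r.2
      · rw [hrr]
      obtain ⟨g1, g2, g3⟩ := hR r hr hrr
      have e1 := hm.2 r hr
      have e2 := hp.2 r hr
      rw [abs_sub_le_abs_sub_iff] at e1 e2 ⊢
      rw [abs_le] at g1 g2
      set p := t r.1
      set q := t r.2
      set p' := t' r.1
      set q' := t' r.2
      rcases lt_abs.1 g3 with g | g
      · have f1 : p + q ≤ 2 * (τ - η) := by
          by_contra hlt
          push Not at hlt
          nlinarith [mul_pos (show 0 < p - q by linarith) (sub_pos.2 hlt)]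
        nlinarith [mul_nonneg (show 0 ≤ p' - q' by linarith)
          (show 0 ≤ 2 * τ - (p' + q') by linarith)]
      · have f1 : 2 * (τ + η) ≤ p + q := by
          by_contra hlt
          push Not at hlt
          nlinarith [mul_pos (show 0 < q - p by linarith) (sub_pos.2 hlt)]
        nlinarith [mul_nonneg (show 0 ≤ q' - p' by linarith)
          (show 0 ≤ p' + q' - 2 * τ by linarith)]
  have hle : sInf S ≤ sSup S := csInf_le_csSup hne hlo hhi
  have v1 := measureReal_mono hsub (measure_Icc_lt_top (μ := volume)).ne
  have v2 := measureReal_mono hsub' (volume_region_ne_top hc t')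
  rw [Real.volume_real_Icc, max_eq_left (by linarith)] at v1
  rw [Real.volume_real_Ioo] at v2
  have := le_max_left (sSup S - η - (sInf S + η)) 0
  linarith

variable [MetricSpace M]

/-- The volume of a region with data in a separated set is almost independent of the chart. -/
theorem NearIso.volume_region_le {B : Set M} {t t' : M → ℝ} {h h' s : ℝ}
    (ht : NearIso B t h) (ht' : NearIso B t' h') (h0 : 0 ≤ h) (h0' : 0 ≤ h') (hs0 : 0 < s)
    (hs : h ≤ s / 50) (hs' : h' ≤ s / 50) (hsep : ∀ z ∈ B, ∀ w ∈ B, z ≠ w → s ≤ dist z w)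
    {C : Set (M × ℝ)} {R : Set (M × M)} {c : M × ℝ} (hc : c ∈ C) (hC : ∀ c ∈ C, c.1 ∈ B)
    (hR : ∀ r ∈ R, r.1 ∈ B ∧ r.2 ∈ B) :
    volume.real (region C R t) ≤ volume.real (region C R t') + 2 * ((h ^ 2 + h' ^ 2) / s) := by
  obtain ⟨σ, hσ, hcmp⟩ := ht.compare ht' h0 h0' hs0 hs hs' hsep (hC c hc)
  set b := t c.1 - σ * t' c.1 with hb
  have hcmp' : ∀ z ∈ B, |t z - (b + σ * t' z)| ≤ (h ^ 2 + h' ^ 2) / s := fun z hz => by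
    have := hcmp z hz
    rwa [show t z - (b + σ * t' z) = (t z - t c.1) - σ * (t' z - t' c.1) by rw [hb]; ring]
  rw [← volume_region_affine C R t' b σ hσ]
  refine volume_region_le_of_abs_sub_le hc (by positivity) (fun c hc => hcmp' _ (hC c hc))
    fun r hr hne => ⟨hcmp' _ (hR r hr).1, hcmp' _ (hR r hr).2, ?_⟩
  have := ht.le_abs h0 hs (hR r hr).1 (hR r hr).2 (hsep _ (hR r hr).1 _ (hR r hr).2 hne)
  refine lt_of_lt_of_le ?_ this
  rw [← mul_div_assoc, div_lt_iff₀ hs0]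
  nlinarith [mul_le_mul hs hs h0 (by linarith), mul_le_mul hs' hs' h0' (by linarith)]

/-- The part of the coordinate Voronoi cell of `p` (among points of `P` within distance `T` of `p`)
within distance `ρ` of the coordinate of `p`. -/
def cell (P : Set M) (p : M) (t : M → ℝ) (ρ T : ℝ) : Set ℝ :=
  region {(p, ρ)} {r | r.1 = p ∧ r.2 ∈ P ∧ dist r.2 p ≤ T} t

theorem mem_cell {P : Set M} {p : M} {t : M → ℝ} {ρ T τ : ℝ} :
    τ ∈ cell P p t ρ T ↔ |τ - t p| ≤ ρ ∧ ∀ q ∈ P, dist q p ≤ T → |τ - t p| ≤ |τ - t q| := by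
  simp only [cell, region, Set.mem_ofPred_eq, Set.mem_singleton_iff, forall_eq]
  constructor
  · rintro ⟨h1, h2⟩
    exact ⟨h1, fun q hq hd => h2 (p, q) ⟨rfl, hq, hd⟩⟩
  · rintro ⟨h1, h2⟩
    refine ⟨h1, ?_⟩
    rintro ⟨a, q⟩ ⟨rfl, hq, hd⟩
    exact h2 q hq hd

theorem measurableSet_cell {P : Set M} {p : M} {t : M → ℝ} {ρ T : ℝ} :
    MeasurableSet (cell P p t ρ T) := measurableSet_region _ _ _

theorem volume_cell_ne_top {P : Set M} {p : M} {t : M → ℝ} {ρ T : ℝ} :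
    volume (cell P p t ρ T) ≠ ⊤ := volume_region_ne_top (Set.mem_singleton _) t

theorem volume_cell_le {P : Set M} {p : M} {t : M → ℝ} {ρ T : ℝ} (h0 : 0 ≤ ρ) :
    volume.real (cell P p t ρ T) ≤ 2 * ρ :=
  _root_.volume_region_le (c := (p, ρ)) (Set.mem_singleton _) h0 t

theorem NearIso.volume_cell_inter_le {B : Set M} {t t' : M → ℝ} {h h' s : ℝ}
    (ht : NearIso B t h) (ht' : NearIso B t' h') (h0 : 0 ≤ h) (h0' : 0 ≤ h') (hs0 : 0 < s)
    (hs : h ≤ s / 50) (hs' : h' ≤ s / 50) (hsep : ∀ z ∈ B, ∀ w ∈ B, z ≠ w → s ≤ dist z w)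
    {P Q : Set M} {p q : M} {ρ ρ' T T' : ℝ} (hp : p ∈ B) (hq : q ∈ B)
    (hP : ∀ z ∈ P, dist z p ≤ T → z ∈ B) (hQ : ∀ z ∈ Q, dist z q ≤ T' → z ∈ B) :
    volume.real (cell P p t ρ T ∩ cell Q q t ρ' T') ≤
      volume.real (cell P p t' ρ T ∩ cell Q q t' ρ' T') + 2 * ((h ^ 2 + h' ^ 2) / s) := by
  rw [cell, cell, cell, cell, region_inter, region_inter]
  refine ht.volume_region_le ht' h0 h0' hs0 hs hs' hsep (c := (p, ρ)) (Or.inl rfl) ?_ ?_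
  · rintro c (rfl | rfl) <;> assumption
  · rintro ⟨a, b⟩ (⟨rfl, h1, h2⟩ | ⟨rfl, h1, h2⟩)
    · exact ⟨hp, hP _ h1 h2⟩
    · exact ⟨hq, hQ _ h1 h2⟩

/-- Cells of distinct points of a separated set overlap in a null set. -/
theorem NearIso.aedisjoint_cell {B : Set M} {t : M → ℝ} {h s : ℝ}
    (ht : NearIso B t h) (h0 : 0 ≤ h) (hs0 : 0 < s)
    (hs : h ≤ s / 50) (hsep : ∀ z ∈ B, ∀ w ∈ B, z ≠ w → s ≤ dist z w)
    {P : Set M} {p q : M} {ρ T : ℝ} (hp : p ∈ B) (hq : q ∈ B) (hpP : p ∈ P) (hqP : q ∈ P)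
    (hT : 2 * ρ + h < T) (hne : p ≠ q) :
    AEDisjoint volume (cell P p t ρ T) (cell P q t ρ T) := by
  rw [AEDisjoint]
  refine measure_mono_null (t := {(t p + t q) / 2}) ?_ Real.volume_singleton
  rintro τ ⟨h1, h2⟩
  rw [mem_cell] at h1 h2
  have h3 : |t p - t q| ≤ 2 * ρ := by
    rw [show t p - t q = (τ - t q) - (τ - t p) by ring]
    exact (abs_sub _ _).trans (by linarith [h1.1, h2.1])
  have h4 : dist p q ≤ T := (ht.dist_le h0 hp hq).trans (by linarith)
  have e1 := h1.2 q hqP (by rwa [dist_comm])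
  have e2 := h2.2 p hpP h4
  have h5 := ht.le_abs h0 hs hp hq (hsep p hp q hq hne)
  have h6 : t p - t q ≠ 0 := fun h => by rw [h, abs_zero] at h5; linarith
  have e3 := le_antisymm e1 e2
  rw [Set.mem_singleton_iff]
  rcases abs_eq_abs.1 e3 with h | h
  · exact absurd (by linarith) h6
  · linarith

end Regions

section Transition

variable {M : Type u} [MetricSpace M]

/-- A finite `r`-separated subset `X` of `E` with a flatness gauge `g`, such that every `x ∈ X` with
small gauge carries a coordinate `t x` on the part of `E` at distance `100 * r` from it. -/
structure ChartedNet (E : Set M) (X : Finset M) (r : ℝ) (g : M → ℝ) (t : M → M → ℝ) : Prop where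
  pos : 0 < r
  mem : ∀ x ∈ X, x ∈ E
  sep : ∀ x ∈ X, ∀ y ∈ X, x ≠ y → r ≤ dist x y
  nonneg : ∀ x, 0 ≤ g x
  chart : ∀ x ∈ X, g x ≤ 1 / 100 → NearIso (E ∩ closedBall x (100 * r)) (t x) (g x * r)

/-- The length assigned to a point of a charted net. -/
def pointLength (X : Finset M) (r : ℝ) (g : M → ℝ) (t : M → M → ℝ) (x : M) : ℝ :=
  if g x ≤ 1 / 100 then volume.real (cell (X : Set M) x (t x) (3 * r) (9 * r)) else 412 * r

namespace ChartedNet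

variable {E : Set M} {X Y : Finset M} {r s : ℝ} {g g' : M → ℝ} {t t' : M → M → ℝ}

theorem gauge_mul_nonneg (hX : ChartedNet E X r g t) (x : M) : 0 ≤ g x * r :=
  mul_nonneg (hX.nonneg x) hX.pos.le

theorem gauge_mul_le (hX : ChartedNet E X r g t) {x : M} (hg : g x ≤ 1 / 100) :
    g x * r ≤ r / 50 := by nlinarith [hX.pos]

theorem nearIso (hX : ChartedNet E X r g t) {x : M} (hx : x ∈ X) (hg : g x ≤ 1 / 100)
    {B : Set M} (hB : ∀ z ∈ B, z ∈ E ∧ dist z x ≤ 100 * r) : NearIso B (t x) (g x * r) :=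
  (hX.chart x hx hg).mono fun z hz => ⟨(hB z hz).1, mem_closedBall.2 (hB z hz).2⟩

theorem card_near (hX : ChartedNet E X r g t) {x : M} (hx : x ∈ X) (hg : g x ≤ 1 / 100) {R : ℝ}
    (hR : R ≤ 40 * r) : (X.filter fun z => dist z x ≤ R).card ≤ 103 := by
  by_cases hR0 : 0 ≤ R
  swap
  · rw [Finset.filter_eq_empty_iff.2]
    · simp
    · intro z _ h
      exact hR0 (dist_nonneg.trans h)
  have hr := hX.pos
  have hB : NearIso (↑(X.filter fun z => dist z x ≤ R) : Set M) (t x) (g x * r) :=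
    hX.nearIso hx hg fun z hz => by
      rw [Finset.mem_coe, Finset.mem_filter] at hz
      exact ⟨hX.mem z hz.1, by linarith [hz.2]⟩
  have := (hB.card_le (hX.gauge_mul_nonneg x) hr (hX.gauge_mul_le hg) ?_ (y := x) ?_ ?_).2
  · rwa [Set.ncard_coe_finset] at this
  · intro z hz w hw
    exact hX.sep z (Finset.mem_filter.1 hz).1 w (Finset.mem_filter.1 hw).1
  · simp [hx, hR0]
  · intro z hz
    exact (Finset.mem_filter.1 hz).2.trans hR

theorem card_flat_near (hX : ChartedNet E X r g t) (x : M) {R : ℝ} (hR : R ≤ 20 * r) :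
    ((X.filter fun z => g z ≤ 1 / 100).filter fun z => dist z x ≤ R).card ≤ 103 := by
  rcases Finset.eq_empty_or_nonempty
    ((X.filter fun z => g z ≤ 1 / 100).filter fun z => dist z x ≤ R) with h | ⟨y, hy⟩
  · rw [h]; simp
  · simp only [Finset.mem_filter] at hy
    refine (Finset.card_le_card ?_).trans (hX.card_near hy.1.1 hy.1.2 (le_refl (40 * r)))
    intro z hz
    simp only [Finset.mem_filter] at hz ⊢
    exact ⟨hz.1.1, by linarith [dist_triangle_right z y x, hz.2, hy.2]⟩

/-- The cell of a flat point of the fine net is covered by the cells of nearby coarse points. -/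
theorem cell_subset_biUnion (hY : ChartedNet E Y s g t) (hXY : X ⊆ Y)
    (hcov : ∀ y ∈ Y, ∃ x ∈ X, dist y x ≤ 2 * s) {y : M} (hy : y ∈ Y) (hg : g y ≤ 1 / 100) :
    cell (Y : Set M) y (t y) (4 * s) (9 * s) ⊆
      ⋃ x ∈ X.filter fun x => dist x y ≤ 11 * s,
        cell (Y : Set M) y (t y) (4 * s) (9 * s) ∩ cell (X : Set M) x (t y) (6 * s) (18 * s) := by
  intro τ hτ
  have hs := hY.pos
  have hn : NearIso {z | z ∈ X ∧ dist z y ≤ 30 * s ∨ z = y} (t y) (g y * s) :=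
    hY.nearIso hy hg fun z hz => by
      rcases hz with ⟨h1, h2⟩ | rfl
      · exact ⟨hY.mem z (hXY h1), by linarith⟩
      · exact ⟨hY.mem z hy, by rw [dist_self]; positivity⟩
  obtain ⟨x₀, hx₀, hd₀⟩ := hcov y hy
  have hx₀' : x₀ ∈ X.filter fun z => dist z y ≤ 30 * s := by
    rw [Finset.mem_filter, dist_comm]; exact ⟨hx₀, by linarith⟩
  obtain ⟨x, hx, hmin⟩ := Finset.exists_min_image (X.filter fun z => dist z y ≤ 30 * s)
    (fun z => |τ - t y z|) ⟨x₀, hx₀'⟩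
  rw [Finset.mem_filter] at hx
  have h1 := (mem_cell.1 hτ).1
  have h2 : |τ - t y x| ≤ 6 * s := by
    refine (hmin x₀ hx₀').trans ?_
    have h3 := (hn y (Or.inr rfl) x₀ (Or.inl (Finset.mem_filter.1 hx₀'))).1
    rw [show τ - t y x₀ = (τ - t y y) + (t y y - t y x₀) by ring]
    exact (abs_add_le _ _).trans (by linarith)
  have h3 : dist x y ≤ 11 * s := by
    have := hn.dist_le (hY.gauge_mul_nonneg y) (Or.inl hx) (Or.inr rfl : y ∈ _)
    have h4 : |t y x - t y y| ≤ 10 * s := by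
      rw [show t y x - t y y = (τ - t y y) - (τ - t y x) by ring]
      exact (abs_sub _ _).trans (by linarith)
    have := hY.gauge_mul_le hg
    linarith
  refine Set.mem_biUnion (x := x) (by simp [hx.1, h3]) ⟨hτ, mem_cell.2 ⟨h2, fun q hq hd => ?_⟩⟩
  refine hmin q (Finset.mem_filter.2 ⟨hq, ?_⟩)
  linarith [dist_triangle q x y]

/-- The contribution of a fixed coarse point. -/
theorem sum_volume_inter_le (hY : ChartedNet E Y s g t) (hX : ChartedNet E X (2 * s) g' t')
    (hXY : X ⊆ Y) {x : M} (hx : x ∈ X) :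
    ∑ y ∈ (Y.filter fun z => g z ≤ 1 / 100).filter (fun y => dist y x ≤ 11 * s),
      volume.real (cell (Y : Set M) y (t y) (4 * s) (9 * s) ∩
        cell (X : Set M) x (t y) (6 * s) (18 * s)) ≤
    pointLength X (2 * s) g' t' x + 824 * s * g' x ^ 2 +
      ∑ y ∈ (Y.filter fun z => g z ≤ 1 / 100).filter (fun y => dist y x ≤ 11 * s),
        2 * s * g y ^ 2 := by
  have hs := hY.pos
  set F := (Y.filter fun z => g z ≤ 1 / 100).filter (fun y => dist y x ≤ 11 * s) with hF
  have hcard : (F.card : ℝ) ≤ 103 := by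
    exact_mod_cast hY.card_flat_near x (show 11 * s ≤ 20 * s by linarith)
  have hsum0 : 0 ≤ ∑ y ∈ F, 2 * s * g y ^ 2 := Finset.sum_nonneg fun y _ => by positivity
  have hsx : 0 ≤ 824 * s * g' x ^ 2 := by positivity
  by_cases hg : g' x ≤ 1 / 100
  · rw [pointLength, if_pos hg, show 3 * (2 * s) = 6 * s by ring, show 9 * (2 * s) = 18 * s by ring]
    have hterm : ∀ y ∈ F, volume.real (cell (Y : Set M) y (t y) (4 * s) (9 * s) ∩
        cell (X : Set M) x (t y) (6 * s) (18 * s)) ≤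
        volume.real (cell (Y : Set M) y (t' x) (4 * s) (9 * s) ∩
          cell (X : Set M) x (t' x) (6 * s) (18 * s)) + (8 * s * g' x ^ 2 + 2 * s * g y ^ 2) := by
      intro y hy
      simp only [hF, Finset.mem_filter] at hy
      have n1 : NearIso {z | z ∈ Y ∧ dist z y ≤ 30 * s} (t y) (g y * s) :=
        hY.nearIso hy.1.1 hy.1.2 fun z hz => ⟨hY.mem z hz.1, by linarith [hz.2]⟩
      have n2 : NearIso {z | z ∈ Y ∧ dist z y ≤ 30 * s} (t' x) (g' x * (2 * s)) :=
        hX.nearIso hx hg fun z hz => ⟨hY.mem z hz.1, by linarith [hz.2, dist_triangle z y x]⟩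
      have hd : dist x y ≤ 11 * s := by rw [dist_comm]; exact hy.2
      refine (n1.volume_cell_inter_le n2 (hY.gauge_mul_nonneg y) (hX.gauge_mul_nonneg x) hs
        (hY.gauge_mul_le hy.1.2) (by nlinarith)
        (fun z hz w hw => hY.sep z hz.1 w hw.1) ⟨hy.1.1, by rw [dist_self]; positivity⟩
        ⟨hXY hx, by linarith⟩ (fun z hz hd => ⟨hz, by linarith⟩)
        (fun z hz hd' => ⟨hXY hz, by linarith [dist_triangle z x y]⟩)).trans (le_of_eq ?_)
      field_simp
      ring
    refine (Finset.sum_le_sum hterm).trans ?_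
    rw [Finset.sum_add_distrib, Finset.sum_add_distrib, Finset.sum_const, nsmul_eq_mul]
    have hcs : F.card * (8 * s * g' x ^ 2) ≤ 824 * s * g' x ^ 2 :=
      (mul_le_mul_of_nonneg_right hcard (by positivity)).trans (by linarith)
    have hdis : ∑ y ∈ F, volume.real (cell (Y : Set M) y (t' x) (4 * s) (9 * s) ∩
        cell (X : Set M) x (t' x) (6 * s) (18 * s)) ≤
        volume.real (cell (X : Set M) x (t' x) (6 * s) (18 * s)) := by
      have n2 : NearIso {z | z ∈ Y ∧ dist z x ≤ 11 * s} (t' x) (g' x * (2 * s)) :=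
        hX.nearIso hx hg fun z hz => ⟨hY.mem z hz.1, by linarith [hz.2]⟩
      have hfin : ∀ y ∈ F, volume (cell (Y : Set M) y (t' x) (4 * s) (9 * s) ∩
          cell (X : Set M) x (t' x) (6 * s) (18 * s)) ≠ ⊤ := fun y _ =>
        ((measure_mono Set.inter_subset_left).trans_lt
          (lt_top_iff_ne_top.2 volume_cell_ne_top)).ne
      rw [← measureReal_biUnion_finset₀ (h := hfin)]
      · exact measureReal_mono (Set.iUnion₂_subset fun _ _ => Set.inter_subset_right)
          volume_cell_ne_top
      · intro y hy z hz hne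
        simp only [hF, Finset.coe_filter, Finset.mem_filter, Set.mem_ofPred_eq] at hy hz
        refine (n2.aedisjoint_cell (hX.gauge_mul_nonneg x) hs (by nlinarith)
          (fun z hz w hw => hY.sep z hz.1 w hw.1) (P := Y) ⟨hy.1.1, hy.2⟩ ⟨hz.1.1, hz.2⟩ hy.1.1
          hz.1.1 (by nlinarith) hne).mono Set.inter_subset_left Set.inter_subset_left
      · exact fun y _ => (measurableSet_cell.inter measurableSet_cell).nullMeasurableSet
    linarith
  · rw [pointLength, if_neg hg]
    have hterm : ∀ y ∈ F, volume.real (cell (Y : Set M) y (t y) (4 * s) (9 * s) ∩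
        cell (X : Set M) x (t y) (6 * s) (18 * s)) ≤ 8 * s := fun y _ =>
      (measureReal_mono Set.inter_subset_left volume_cell_ne_top).trans
        ((volume_cell_le (by positivity)).trans (by linarith))
    have := Finset.sum_le_card_nsmul F _ _ hterm
    rw [nsmul_eq_mul] at this
    nlinarith

/-- Comparison of the total length of fine cells with the lengths of coarse cells. -/
theorem sum_volume_cell_le (hY : ChartedNet E Y s g t) (hX : ChartedNet E X (2 * s) g' t')
    (hXY : X ⊆ Y) (hcov : ∀ y ∈ Y, ∃ x ∈ X, dist y x ≤ 2 * s) :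
    ∑ y ∈ Y.filter (fun z => g z ≤ 1 / 100),
      volume.real (cell (Y : Set M) y (t y) (4 * s) (9 * s)) ≤
    ∑ x ∈ X, pointLength X (2 * s) g' t' x + 824 * s * ∑ x ∈ X, g' x ^ 2 +
      206 * s * ∑ y ∈ Y, g y ^ 2 := by
  have hs := hY.pos
  set F := Y.filter (fun z => g z ≤ 1 / 100) with hF
  have h1 : ∀ y ∈ F, volume.real (cell (Y : Set M) y (t y) (4 * s) (9 * s)) ≤
      ∑ x ∈ X.filter fun x => dist x y ≤ 11 * s,
        volume.real (cell (Y : Set M) y (t y) (4 * s) (9 * s) ∩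
          cell (X : Set M) x (t y) (6 * s) (18 * s)) := by
    intro y hy
    rw [hF, Finset.mem_filter] at hy
    refine (measureReal_mono (hY.cell_subset_biUnion hXY hcov hy.1 hy.2) ?_).trans
      (measureReal_biUnion_finset_le _ _)
    refine ((measure_mono (Set.iUnion₂_subset fun _ _ => Set.inter_subset_left)).trans_lt
      (lt_top_iff_ne_top.2 (volume_cell_ne_top (P := (Y : Set M)) (p := y) (t := t y)
        (ρ := 4 * s) (T := 9 * s)))).ne
  have hswap : ∀ f : M → M → ℝ, ∑ y ∈ F, ∑ x ∈ X.filter (fun x => dist x y ≤ 11 * s), f y x =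
      ∑ x ∈ X, ∑ y ∈ F.filter (fun y => dist y x ≤ 11 * s), f y x := fun f => by
    refine Finset.sum_comm' fun y x => ?_
    simp only [Finset.mem_filter, dist_comm x y]
    tauto
  refine (Finset.sum_le_sum h1).trans ?_
  rw [hswap]
  refine (Finset.sum_le_sum fun x hx => hY.sum_volume_inter_le hX hXY hx).trans ?_
  rw [Finset.sum_add_distrib, Finset.sum_add_distrib, ← hswap fun y _ => 2 * s * g y ^ 2,
    Finset.mul_sum, Finset.mul_sum]
  gcongr ?_ + ?_
  · rfl
  · calc ∑ y ∈ F, ∑ x ∈ X.filter (fun x => dist x y ≤ 11 * s), 2 * s * g y ^ 2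
        ≤ ∑ y ∈ F, 206 * s * g y ^ 2 := by
          refine Finset.sum_le_sum fun y hy => ?_
          rw [hF, Finset.mem_filter] at hy
          rw [Finset.sum_const, nsmul_eq_mul]
          have hc : ((X.filter fun x => dist x y ≤ 11 * s).card : ℝ) ≤ 103 := by
            exact_mod_cast (Finset.card_le_card (Finset.filter_subset_filter _ hXY)).trans
              (hY.card_near hy.1 hy.2 (by linarith))
          exact (mul_le_mul_of_nonneg_right hc (by positivity)).trans (by linarith)
      _ ≤ _ := Finset.sum_le_sum_of_subset_of_nonneg (Finset.filter_subset _ _)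
          fun y _ _ => by positivity

end ChartedNet

end Transition

section Potential

variable {M : Type u} [MetricSpace M]

/-- The coordinate `t` sees no point of `Y` near `y` on at least one of the two sides of `y`. -/
def IsEnd (Y : Finset M) (s : ℝ) (t : M → ℝ) (y : M) : Prop :=
  (¬∃ z ∈ Y, dist z y ≤ 9 * s ∧ 0 < t z - t y ∧ t z - t y ≤ 8 * s) ∨
    ¬∃ z ∈ Y, dist z y ≤ 9 * s ∧ 0 < t y - t z ∧ t y - t z ≤ 8 * s

theorem cell_mono_radius {P : Set M} {p : M} {t : M → ℝ} {ρ ρ' T : ℝ} (h : ρ ≤ ρ') :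
    cell P p t ρ T ⊆ cell P p t ρ' T := fun τ hτ => by
  rw [mem_cell] at hτ ⊢
  exact ⟨hτ.1.trans h, hτ.2⟩

theorem volume_cell_add_le_of_isEnd {Y : Finset M} {s : ℝ} {t : M → ℝ} {y : M} (hs : 0 < s)
    (hy : IsEnd Y s t y) :
    volume.real (cell (Y : Set M) y t (3 * s) (9 * s)) + s ≤
      volume.real (cell (Y : Set M) y t (4 * s) (9 * s)) := by
  obtain ⟨I, hI, hvol, hout, hin⟩ : ∃ I : Set ℝ, MeasurableSet I ∧ volume.real I = s ∧
      (∀ τ ∈ I, 3 * s < |τ - t y|) ∧ I ⊆ cell (Y : Set M) y t (4 * s) (9 * s) := by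
    rcases hy with hy | hy
    · refine ⟨Set.Ioc (t y + 3 * s) (t y + 4 * s), measurableSet_Ioc, ?_, ?_, ?_⟩
      · rw [Real.volume_real_Ioc, max_eq_left] <;> linarith
      · rintro τ ⟨h1, h2⟩
        exact lt_abs.2 (Or.inl (by linarith))
      · rintro τ ⟨h1, h2⟩
        have hp : |τ - t y| = τ - t y := abs_of_pos (by linarith)
        rw [mem_cell, hp]
        refine ⟨by linarith, fun q hq hd => ?_⟩
        by_cases hq1 : t q ≤ t y
        · exact le_abs.2 (Or.inl (by linarith))
        · have : ¬ t q - t y ≤ 8 * s := fun h => hy ⟨q, hq, hd, by linarith, h⟩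
          exact le_abs.2 (Or.inr (by linarith))
    · refine ⟨Set.Ico (t y - 4 * s) (t y - 3 * s), measurableSet_Ico, ?_, ?_, ?_⟩
      · rw [Real.volume_real_Ico, max_eq_left] <;> linarith
      · rintro τ ⟨h1, h2⟩
        exact lt_abs.2 (Or.inr (by linarith))
      · rintro τ ⟨h1, h2⟩
        have hp : |τ - t y| = -(τ - t y) := abs_of_neg (by linarith)
        rw [mem_cell, hp]
        refine ⟨by linarith, fun q hq hd => ?_⟩
        by_cases hq1 : t y ≤ t q
        · exact le_abs.2 (Or.inr (by linarith))
        · have : ¬ t y - t q ≤ 8 * s := fun h => hy ⟨q, hq, hd, by linarith, h⟩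
          exact le_abs.2 (Or.inl (by linarith))
  have hd : Disjoint (cell (Y : Set M) y t (3 * s) (9 * s)) I :=
    Set.disjoint_left.2 fun τ h1 h2 => absurd (mem_cell.1 h1).1 (not_le.2 (hout τ h2))
  have hunion := measureReal_union hd hI volume_cell_ne_top
    ((measure_mono hin).trans_lt (lt_top_iff_ne_top.2 volume_cell_ne_top)).ne
  rw [hvol] at hunion
  rw [← hunion]
  exact measureReal_mono (Set.union_subset (cell_mono_radius (by linarith)) hin) volume_cell_ne_top

/-- The points of a charted net which are not flat, or which are ends of the net. -/
def badPoints (Y : Finset M) (s : ℝ) (g : M → ℝ) (t : M → M → ℝ) : Finset M :=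
  Y.filter fun y => g y ≤ 1 / 100 → IsEnd Y s (t y) y

namespace ChartedNet

variable {E : Set M} {X Y : Finset M} {r s : ℝ} {g g' : M → ℝ} {t t' : M → M → ℝ}

theorem le_pointLength (hY : ChartedNet E Y s g t) {y : M} (hy : y ∈ Y) :
    9 / 10 * s ≤ pointLength Y s g t y := by
  have hs := hY.pos
  rw [pointLength]
  split_ifs with hg
  swap
  · linarith
  have hsub : Set.Icc (t y y - 9 / 20 * s) (t y y + 9 / 20 * s) ⊆
      cell (Y : Set M) y (t y) (3 * s) (9 * s) := by
    rintro τ ⟨h1, h2⟩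
    have h3 : |τ - t y y| ≤ 9 / 20 * s := abs_le.2 ⟨by linarith, by linarith⟩
    refine mem_cell.2 ⟨by linarith, fun q hq hd => ?_⟩
    by_cases hqy : q = y
    · rw [hqy]
    have hn : NearIso {z | z ∈ Y ∧ dist z y ≤ 9 * s} (t y) (g y * s) :=
      hY.nearIso hy hg fun z hz => ⟨hY.mem z hz.1, by linarith [hz.2]⟩
    have h4 := hn.le_abs (hY.gauge_mul_nonneg y) (hY.gauge_mul_le hg) ⟨hq, hd⟩
      ⟨hy, by rw [dist_self]; positivity⟩ (hY.sep q hq y hy hqy)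
    have h5 : |t y q - t y y| ≤ |τ - t y y| + |τ - t y q| := by
      rw [show t y q - t y y = (τ - t y y) - (τ - t y q) by ring]
      exact abs_sub _ _
    linarith
  have := measureReal_mono hsub (volume_cell_ne_top (P := (Y : Set M)))
  rw [Real.volume_real_Icc, max_eq_left (by linarith)] at this
  linarith

theorem pointLength_le (hX : ChartedNet E X r g t) (x : M) :
    pointLength X r g t x ≤ 412 * r := by
  have hr := hX.pos
  rw [pointLength]
  split_ifs
  · exact (volume_cell_le (by positivity)).trans (by linarith)
  · rfl

theorem sum_pointLength_add_le (hY : ChartedNet E Y s g t) (hX : ChartedNet E X (2 * s) g' t')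
    (hXY : X ⊆ Y) (hcov : ∀ y ∈ Y, ∃ x ∈ X, dist y x ≤ 2 * s) :
    ∑ y ∈ Y, pointLength Y s g t y + s * (badPoints Y s g t).card ≤
      ∑ x ∈ X, pointLength X (2 * s) g' t' x + 5000000 * (2 * s * ∑ x ∈ X, g' x ^ 2) +
        5000000 * (s * ∑ y ∈ Y, g y ^ 2) := by
  have hs := hY.pos
  have h1 := hY.sum_volume_cell_le hX hXY hcov
  have hX0 : 0 ≤ s * ∑ x ∈ X, g' x ^ 2 :=
    mul_nonneg hs.le (Finset.sum_nonneg fun x _ => sq_nonneg _)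
  have hY0 : 0 ≤ s * ∑ x ∈ Y, g x ^ 2 :=
    mul_nonneg hs.le (Finset.sum_nonneg fun x _ => sq_nonneg _)
  have hbad : s * ((badPoints Y s g t).card : ℝ) =
      ∑ y ∈ Y, if (g y ≤ 1 / 100 → IsEnd Y s (t y) y) then s else 0 := by
    rw [← Finset.sum_filter, Finset.sum_const, nsmul_eq_mul, mul_comm]
    rfl
  have hterm : ∀ y ∈ Y, (pointLength Y s g t y +
      if (g y ≤ 1 / 100 → IsEnd Y s (t y) y) then s else 0) ≤
      (if g y ≤ 1 / 100 then volume.real (cell (Y : Set M) y (t y) (4 * s) (9 * s)) else 0) +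
        4130000 * s * g y ^ 2 := by
    intro y hy
    have hsg : 0 ≤ s * g y ^ 2 := by positivity
    rw [pointLength]
    by_cases hg : g y ≤ 1 / 100
    · simp only [hg, true_imp_iff, if_true]
      split_ifs with he
      · have := volume_cell_add_le_of_isEnd hs he
        linarith
      · have : volume.real (cell (Y : Set M) y (t y) (3 * s) (9 * s)) ≤
            volume.real (cell (Y : Set M) y (t y) (4 * s) (9 * s)) :=
          measureReal_mono (cell_mono_radius (by linarith)) volume_cell_ne_top
        linarith
    · simp only [hg, false_imp_iff, if_true, if_false]
      have : (1 / 100 : ℝ) ^ 2 ≤ g y ^ 2 := by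
        push Not at hg
        exact pow_le_pow_left₀ (by norm_num) hg.le 2
      nlinarith
  have h2 := Finset.sum_le_sum hterm
  rw [Finset.sum_add_distrib, Finset.sum_add_distrib, ← hbad, ← Finset.sum_filter,
    ← Finset.mul_sum] at h2
  linarith

/-- The points of a charted net close to a bad point. -/
def nearBad (Y : Finset M) (s : ℝ) (g : M → ℝ) (t : M → M → ℝ) : Finset M :=
  Y.filter fun y => ∃ w ∈ badPoints Y s g t, dist y w ≤ 18 * s

theorem card_nearBad_le (hY : ChartedNet E Y s g t) :
    (nearBad Y s g t).card ≤ 104 * (badPoints Y s g t).card := by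
  have hs := hY.pos
  have hsub : nearBad Y s g t ⊆ badPoints Y s g t ∪ (badPoints Y s g t).biUnion fun w =>
      (Y.filter fun z => g z ≤ 1 / 100).filter fun z => dist z w ≤ 18 * s := by
    intro y hy
    rw [nearBad, Finset.mem_filter] at hy
    obtain ⟨hyY, w, hw, hd⟩ := hy
    by_cases hg : g y ≤ 1 / 100
    · refine Finset.mem_union_right _ (Finset.mem_biUnion.2 ⟨w, hw, ?_⟩)
      simp only [Finset.mem_filter]
      exact ⟨⟨hyY, hg⟩, hd⟩
    · exact Finset.mem_union_left _ (Finset.mem_filter.2 ⟨hyY, fun h => absurd h hg⟩)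
  refine (Finset.card_le_card hsub).trans ((Finset.card_union_le _ _).trans ?_)
  have := Finset.card_biUnion_le_card_mul (badPoints Y s g t) (fun w =>
      (Y.filter fun z => g z ≤ 1 / 100).filter fun z => dist z w ≤ 18 * s) 103
      fun w _ => hY.card_flat_near w (by linarith)
  linarith

end ChartedNet

/-- Total control of the bad points of a sequence of charted nets. -/
theorem sum_card_badPoints_le {E : Set M} {X : ℕ → Finset M} {r : ℝ} {g : ℕ → M → ℝ}
    {t : ℕ → M → M → ℝ} (hX : ∀ k, ChartedNet E (X k) (r / 2 ^ k) (g k) (t k))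
    (hmono : ∀ k, X k ⊆ X (k + 1)) (hcov : ∀ k, ∀ y ∈ X (k + 1), ∃ x ∈ X k, dist y x ≤ r / 2 ^ k)
    (h0 : (X 0).card = 1) (n : ℕ) :
    9 / 10 * (r / 2 ^ n * (X n).card) + ∑ k ∈ Finset.range n, r / 2 ^ (k + 1) *
      (badPoints (X (k + 1)) (r / 2 ^ (k + 1)) (g (k + 1)) (t (k + 1))).card ≤
      412 * r + 10000000 * ∑ k ∈ Finset.range (n + 1), r / 2 ^ k * ∑ x ∈ X k, g k x ^ 2 := by
  have hG : ∀ k, 0 ≤ r / 2 ^ k * ∑ x ∈ X k, g k x ^ 2 := fun k =>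
    mul_nonneg (hX k).pos.le (Finset.sum_nonneg fun x _ => sq_nonneg _)
  have key : ∀ n : ℕ, ∑ x ∈ X n, pointLength (X n) (r / 2 ^ n) (g n) (t n) x +
      5000000 * (r / 2 ^ n * ∑ x ∈ X n, g n x ^ 2) +
      ∑ k ∈ Finset.range n, r / 2 ^ (k + 1) *
        (badPoints (X (k + 1)) (r / 2 ^ (k + 1)) (g (k + 1)) (t (k + 1))).card ≤
      412 * r + 10000000 * ∑ k ∈ Finset.range (n + 1), r / 2 ^ k * ∑ x ∈ X k, g k x ^ 2 := by
    intro n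
    induction n with
    | zero =>
      have h1 := Finset.sum_le_card_nsmul (X 0) _ _ fun x _ => (hX 0).pointLength_le x
      rw [h0] at h1
      have := hG 0
      simp only [pow_zero, div_one, one_smul] at h1 this
      simp only [Finset.range_zero, Finset.sum_empty, zero_add, Finset.range_one,
        Finset.sum_singleton, pow_zero, div_one]
      linarith
    | succ n ih =>
      rw [Finset.sum_range_succ, Finset.sum_range_succ (n := n + 1)]
      have h2 : 2 * (r / 2 ^ (n + 1)) = r / 2 ^ n := by rw [pow_succ]; field_simp
      have h3 := (hX (n + 1)).sum_pointLength_add_le (X := X n) (g' := g n) (t' := t n)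
        (by rw [h2]; exact hX n) (hmono n) (by rw [h2]; exact hcov n)
      rw [h2] at h3
      have := hG (n + 1)
      linarith
  have h1 := Finset.card_nsmul_le_sum (X n) _ _ fun x hx => (hX n).le_pointLength hx
  rw [nsmul_eq_mul] at h1
  have := key n
  have := hG n
  linarith

end Potential

section Connectivity

variable {M : Type u} [MetricSpace M]

namespace ChartedNet

variable {E : Set M} {Y : Finset M} {s : ℝ} {g : M → ℝ} {t : M → M → ℝ}

/-- A point which is not bad has neighbours on both sides. -/
theorem exists_closer (hY : ChartedNet E Y s g t) {x y : M} (hy : y ∈ Y) (hx : x ∈ Y)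
    (hbad : y ∉ badPoints Y s g t) (h1 : 9 * s < dist y x) (h2 : dist y x ≤ 18 * s) :
    ∃ z ∈ Y, dist y z ≤ 9 * s ∧ dist z x ≤ dist y x - s / 2 := by
  have hs := hY.pos
  rw [badPoints, Finset.mem_filter, IsEnd] at hbad
  simp only [hy, true_and, Classical.not_imp, not_or, not_not] at hbad
  obtain ⟨hg, ⟨z, hz, hzd, hz1, hz2⟩, ⟨w, hw, hwd, hw1, hw2⟩⟩ := hbad
  have hn : NearIso {z | z ∈ Y ∧ dist z y ≤ 18 * s} (t y) (g y * s) :=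
    hY.nearIso hy hg fun z hz => ⟨hY.mem z hz.1, by linarith [hz.2]⟩
  have h0 := hY.gauge_mul_nonneg y
  have hgs := hY.gauge_mul_le hg
  have hym : y ∈ {z | z ∈ Y ∧ dist z y ≤ 18 * s} := ⟨hy, by rw [dist_self]; positivity⟩
  have hxm : x ∈ {z | z ∈ Y ∧ dist z y ≤ 18 * s} := ⟨hx, by rwa [dist_comm]⟩
  have hzm : z ∈ {z | z ∈ Y ∧ dist z y ≤ 18 * s} := ⟨hz, by linarith⟩
  have hwm : w ∈ {z | z ∈ Y ∧ dist z y ≤ 18 * s} := ⟨hw, by linarith⟩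
  have hxy := hn.dist_le h0 hym hxm
  have hxy' := (hn y hym x hxm).1
  have hlarge : 8 * s < |t y y - t y x| := by linarith
  rcases lt_abs.1 hlarge with hl | hl
  · refine ⟨w, hw, by rwa [dist_comm], ?_⟩
    have hne : w ≠ y := by rintro rfl; simp at hw1
    have h3 := hn.le_abs h0 hgs hwm hym (hY.sep w hw y hy hne)
    rw [abs_of_neg (by linarith)] at h3
    have h4 := hn.dist_le h0 hwm hxm
    rw [abs_of_pos (by linarith)] at h4 hxy'
    linarith
  · refine ⟨z, hz, by rwa [dist_comm], ?_⟩
    have hne : z ≠ y := by rintro rfl; simp at hz1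
    have h3 := hn.le_abs h0 hgs hzm hym (hY.sep z hz y hy hne)
    rw [abs_of_pos (by linarith)] at h3
    have h4 := hn.dist_le h0 hzm hxm
    rw [abs_of_neg (by linarith)] at h4 hxy'
    linarith

theorem related_of_dist_le (hY : ChartedNet E Y s g t) {R : M → M → Prop} (hR : Equivalence R)
    (hshort : ∀ a ∈ Y, ∀ b ∈ Y, dist a b ≤ 9 * s → R a b)
    (hbad : ∀ a ∈ nearBad Y s g t, ∀ b ∈ nearBad Y s g t, dist a b ≤ 18 * s → R a b)
    {x x' : M} (hx : x ∈ Y) (hx' : x' ∈ Y) (hd : dist x x' ≤ 18 * s) : R x x' := by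
  have hs := hY.pos
  have key : ∀ a ∈ Y, a ∉ nearBad Y s g t → ∀ m : ℕ, ∀ y ∈ Y, dist y a ≤ 18 * s →
      dist y a ≤ 9 * s + m * (s / 2) → R y a := by
    intro a ha hna m
    induction m with
    | zero =>
      intro y hy _ h
      exact hshort y hy a ha (by simpa using h)
    | succ m ih =>
      intro y hy h18 h
      by_cases h9 : dist y a ≤ 9 * s
      · exact hshort y hy a ha h9
      have hyb : y ∉ badPoints Y s g t := fun hb =>
        hna (Finset.mem_filter.2 ⟨ha, y, hb, by rwa [dist_comm]⟩)
      obtain ⟨z, hz, hz1, hz2⟩ := hY.exists_closer hy ha hyb (not_le.1 h9) h18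
      push_cast at h
      exact hR.trans (hshort y hy z hz hz1) (ih z hz (by linarith) (by linarith))
  by_cases h1 : x' ∈ nearBad Y s g t
  · by_cases h2 : x ∈ nearBad Y s g t
    · exact hbad x h2 x' h1 hd
    · exact hR.symm (key x hx h2 18 x' hx' (by rwa [dist_comm])
        (by rw [dist_comm] at hd; push_cast; linarith))
  · exact key x' hx' h1 18 x hx hd (by push_cast; linarith)

end ChartedNet

/-- Adjacency used to connect the points of the `n`-th net: points near bad points of a level up to
`n` are joined at the scale of that level, and points of level `n` are joined at scale `n`. -/
def netAdj (X : ℕ → Finset M) (r : ℝ) (g : ℕ → M → ℝ) (t : ℕ → M → M → ℝ) (n : ℕ) (a b : M) :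
    Prop :=
  (∃ k < n, a ∈ ChartedNet.nearBad (X (k + 1)) (r / 2 ^ (k + 1)) (g (k + 1)) (t (k + 1)) ∧
    b ∈ ChartedNet.nearBad (X (k + 1)) (r / 2 ^ (k + 1)) (g (k + 1)) (t (k + 1)) ∧
      dist a b ≤ 18 * (r / 2 ^ (k + 1))) ∨
    (a ∈ X n ∧ b ∈ X n ∧ dist a b ≤ 9 * (r / 2 ^ n))

theorem netAdj_symm {X : ℕ → Finset M} {r : ℝ} {g : ℕ → M → ℝ} {t : ℕ → M → M → ℝ} {n : ℕ}
    {a b : M} (h : netAdj X r g t n a b) : netAdj X r g t n b a := by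
  rcases h with ⟨k, hk, ha, hb, hd⟩ | ⟨ha, hb, hd⟩
  · exact Or.inl ⟨k, hk, hb, ha, by rwa [dist_comm]⟩
  · exact Or.inr ⟨hb, ha, by rwa [dist_comm]⟩

theorem equivalence_reflTransGen_netAdj (X : ℕ → Finset M) (r : ℝ) (g : ℕ → M → ℝ)
    (t : ℕ → M → M → ℝ) (n : ℕ) : Equivalence (Relation.ReflTransGen (netAdj X r g t n)) := by
  have hsymm : ∀ {a b}, Relation.ReflTransGen (netAdj X r g t n) a b →
      Relation.ReflTransGen (netAdj X r g t n) b a := fun h => by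
    induction h with
    | refl => exact Relation.ReflTransGen.refl
    | tail _ h ih => exact Relation.ReflTransGen.head (netAdj_symm h) ih
  exact ⟨fun _ => Relation.ReflTransGen.refl, hsymm, Relation.ReflTransGen.trans⟩

/-- All points of the `n`-th net are connected to any point of the initial net. -/
theorem reflTransGen_netAdj {E : Set M} {X : ℕ → Finset M} {r : ℝ} {g : ℕ → M → ℝ}
    {t : ℕ → M → M → ℝ} (hX : ∀ k, ChartedNet E (X k) (r / 2 ^ k) (g k) (t k))
    (hmono : ∀ k, X k ⊆ X (k + 1)) (hcov : ∀ k, ∀ y ∈ X (k + 1), ∃ x ∈ X k, dist y x ≤ r / 2 ^ k)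
    {x₀ : M} (h0 : X 0 = {x₀}) (n : ℕ) {x : M} (hx : x ∈ X n) :
    Relation.ReflTransGen (netAdj X r g t n) x₀ x := by
  have hR := equivalence_reflTransGen_netAdj X r g t n
  have hhalf : ∀ k, 2 * (r / 2 ^ (k + 1)) = r / 2 ^ k := fun k => by rw [pow_succ]; field_simp
  have hlev : ∀ j k, j + k = n → ∀ a ∈ X k, ∀ b ∈ X k, dist a b ≤ 9 * (r / 2 ^ k) →
      Relation.ReflTransGen (netAdj X r g t n) a b := by
    intro j
    induction j with
    | zero =>
      intro k hk a ha b hb hd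
      rw [zero_add] at hk
      subst hk
      exact Relation.ReflTransGen.single (Or.inr ⟨ha, hb, hd⟩)
    | succ j ih =>
      intro k hk a ha b hb hd
      refine (hX (k + 1)).related_of_dist_le hR (ih (k + 1) (by omega)) ?_ (hmono k ha)
        (hmono k hb) (by linarith [hhalf k])
      intro p hp q hq hpq
      exact Relation.ReflTransGen.single (Or.inl ⟨k, by omega, hp, hq, hpq⟩)
  have hroot : ∀ k ≤ n, ∀ y ∈ X k, Relation.ReflTransGen (netAdj X r g t n) x₀ y := by
    intro k
    induction k with
    | zero =>
      intro _ y hy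
      rw [h0, Finset.mem_singleton] at hy
      rw [hy]
    | succ k ih =>
      intro hk y hy
      obtain ⟨z, hz, hd⟩ := hcov k y hy
      refine hR.trans (ih (by omega) z hz) (hlev (n - (k + 1)) (k + 1) (by omega) z (hmono k hz) y
        hy ?_)
      rw [dist_comm]
      have := (hX (k + 1)).pos
      linarith [hhalf k]
  exact hroot n le_rfl x hx

end Connectivity

section Tours

variable {H : Type u} [NormedAddCommGroup H]

/-- `f` is a unit speed path inside `K` visiting all points of `S` during `[0, L]`. -/
structure IsTour (f : ℝ → H) (K : Set H) (S : Set H) (L : ℝ) : Prop where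
  lipschitz : LipschitzWith 1 f
  mem : ∀ τ, f τ ∈ K
  visits : ∀ v ∈ S, ∃ τ ∈ Set.Icc 0 L, f τ = v

theorem IsTour.mono {f : ℝ → H} {K S S' : Set H} {L L' : ℝ} (hf : IsTour f K S L) (hS : S' ⊆ S)
    (hL : L ≤ L') : IsTour f K S' L' :=
  ⟨hf.lipschitz, hf.mem, fun v hv =>
    let ⟨τ, hτ, h⟩ := hf.visits v (hS hv)
    ⟨τ, ⟨hτ.1, hτ.2.trans hL⟩, h⟩⟩

variable [NormedSpace ℝ H]

/-- A tour can be extended by an excursion along a segment. -/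
theorem IsTour.exists_insert {f : ℝ → H} {K S : Set H} {L w : ℝ} (hf : IsTour f K S L)
    (hK : Convex ℝ K) {a b : H} (ha : a ∈ S) (hb : b ∈ K) (hw : dist a b ≤ w) :
    ∃ f', IsTour f' K (insert b S) (L + 2 * w) := by
  obtain ⟨t₀, ht₀, hta⟩ := hf.visits a ha
  have hw0 : 0 ≤ w := dist_nonneg.trans hw
  by_cases hab : a = b
  · subst hab
    rw [Set.insert_eq_of_mem ha]
    exact ⟨f, hf.mono subset_rfl (by linarith)⟩
  set d := dist a b with hd
  have hd0 : 0 < d := dist_pos.2 hab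
  set c : ℝ → ℝ := fun τ => max 0 (min (τ - t₀) (2 * d)) with hc
  have hc0 : ∀ τ, τ ≤ t₀ → c τ = 0 := fun τ h => by
    simp only [hc]
    exact max_eq_left ((min_le_left _ _).trans (by linarith))
  have hc2 : ∀ τ, t₀ + 2 * d ≤ τ → c τ = 2 * d := fun τ h => by
    simp only [hc]
    rw [min_eq_right (by linarith), max_eq_right (by linarith)]
  have hc1 : ∀ τ, t₀ ≤ τ → τ ≤ t₀ + 2 * d → c τ = τ - t₀ := fun τ h h' => by
    simp only [hc]
    rw [min_eq_left (by linarith), max_eq_right (by linarith)]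
  have hcm : ∀ τ τ', τ ≤ τ' → c τ ≤ c τ' ∧ c τ' - c τ ≤ τ' - τ := by
    intro τ τ' h
    refine ⟨max_le_max le_rfl (min_le_min (by linarith) le_rfl), ?_⟩
    rcases le_total τ t₀ with h1 | h1
    · rw [hc0 τ h1]
      rcases le_total τ' t₀ with h2 | h2
      · rw [hc0 τ' h2]; linarith
      · rcases le_total τ' (t₀ + 2 * d) with h3 | h3
        · rw [hc1 τ' h2 h3]; linarith
        · rw [hc2 τ' h3]; linarith
    · rcases le_total τ (t₀ + 2 * d) with h2 | h2
      · rw [hc1 τ h1 h2]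
        rcases le_total τ' (t₀ + 2 * d) with h3 | h3
        · rw [hc1 τ' (h1.trans h) h3]; linarith
        · rw [hc2 τ' h3]; linarith
      · rw [hc2 τ h2, hc2 τ' (h2.trans h)]; linarith
  set v : H := d⁻¹ • (b - a) with hv
  have hv1 : ‖v‖ = 1 := by
    rw [hv, norm_smul, norm_inv, Real.norm_of_nonneg hd0.le, ← dist_eq_norm, dist_comm, ← hd,
      inv_mul_cancel₀ hd0.ne']
  set f' : ℝ → H := fun τ => f (τ - c τ) + (d - |c τ - d|) • v with hf'
  have hbd : ∀ τ τ', τ ≤ τ' → dist (f' τ) (f' τ') ≤ τ' - τ := by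
    intro τ τ' h
    obtain ⟨h1, h2⟩ := hcm τ τ' h
    have e1 := hf.lipschitz.dist_le_mul (τ - c τ) (τ' - c τ')
    rw [NNReal.coe_one, one_mul, Real.dist_eq, abs_sub_comm, abs_of_nonneg (by linarith)] at e1
    have e2 : dist ((d - |c τ - d|) • v) ((d - |c τ' - d|) • v) ≤ c τ' - c τ := by
      rw [dist_eq_norm, ← sub_smul, norm_smul, hv1, mul_one, Real.norm_eq_abs]
      have := abs_abs_sub_abs_le_abs_sub (c τ' - d) (c τ - d)
      rw [show d - |c τ - d| - (d - |c τ' - d|) = |c τ' - d| - |c τ - d| by ring]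
      refine this.trans ?_
      rw [show c τ' - d - (c τ - d) = c τ' - c τ by ring, abs_of_nonneg (by linarith)]
    exact (dist_add_add_le _ _ _ _).trans (by linarith)
  refine ⟨f', ?_, ?_, ?_⟩
  · refine LipschitzWith.of_dist_le_mul fun τ τ' => ?_
    rw [NNReal.coe_one, one_mul, Real.dist_eq]
    rcases le_total τ τ' with h | h
    · rw [abs_sub_comm, abs_of_nonneg (by linarith)]
      exact hbd τ τ' h
    · rw [dist_comm, abs_of_nonneg (by linarith)]
      exact hbd τ' τ h
  · intro τ
    rcases le_total τ t₀ with h1 | h1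
    · have : f' τ = f τ := by
        simp only [hf', hc0 τ h1, sub_zero, zero_sub, abs_neg, abs_of_pos hd0, sub_self, zero_smul,
          add_zero]
      rw [this]; exact hf.mem τ
    rcases le_total τ (t₀ + 2 * d) with h2 | h2
    · have e1 : f' τ = a + ((d - |τ - t₀ - d|) / d) • (b - a) := by
        simp only [hf', hc1 τ h1 h2, hv, smul_smul, sub_sub_cancel, hta, div_eq_mul_inv]
      rw [e1]
      refine hK.add_smul_sub_mem (hta ▸ hf.mem t₀) hb ⟨?_, ?_⟩
      · refine div_nonneg (sub_nonneg.2 (abs_le.2 ⟨?_, ?_⟩)) hd0.le <;> linarith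
      · rw [div_le_one hd0]
        linarith [abs_nonneg (τ - t₀ - d)]
    · have : f' τ = f (τ - 2 * d) := by
        simp only [hf', hc2 τ h2]
        rw [show 2 * d - d = d by ring, abs_of_pos hd0, sub_self, zero_smul, add_zero]
      rw [this]; exact hf.mem _
  · intro z hz
    rcases hz with rfl | hz
    · refine ⟨t₀ + d, ⟨by linarith [ht₀.1], by linarith [ht₀.2]⟩, ?_⟩
      simp only [hf', hc1 (t₀ + d) (by linarith) (by linarith)]
      rw [show t₀ + d - t₀ = d by ring, sub_self, abs_zero, sub_zero, add_sub_cancel_right, hta, hv,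
        smul_inv_smul₀ hd0.ne', add_sub_cancel]
    · obtain ⟨τ, hτ, rfl⟩ := hf.visits z hz
      rcases le_total τ t₀ with h1 | h1
      · refine ⟨τ, ⟨hτ.1, by linarith [hτ.2]⟩, ?_⟩
        simp only [hf', hc0 τ h1, sub_zero, zero_sub, abs_neg, abs_of_pos hd0, sub_self, zero_smul,
          add_zero]
      · refine ⟨τ + 2 * d, ⟨by linarith [hτ.1], by linarith [hτ.2]⟩, ?_⟩
        simp only [hf', hc2 (τ + 2 * d) (by linarith)]
        rw [show 2 * d - d = d by ring, abs_of_pos hd0, sub_self, zero_smul, add_zero,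
          add_sub_cancel_right]

theorem exists_crossing_of_reflTransGen {α : Type u} {adj : α → α → Prop} {a b : α}
    (h : Relation.ReflTransGen adj a b) {S : Set α} (ha : a ∈ S) (hb : b ∉ S) :
    ∃ p ∈ S, ∃ q ∉ S, adj p q := by
  induction h with
  | refl => exact absurd ha hb
  | tail h1 h2 ih =>
    rename_i p q
    by_cases hp : p ∈ S
    · exact ⟨p, hp, q, hb, h2⟩
    · exact ih hp

/-- A connected finite graph in a convex set admits a tour whose length is controlled by a weight
bounding the lengths of the edges. -/
theorem exists_isTour {K : Set H} (hK : Convex ℝ K) {V : Finset H} (hV : (V : Set H) ⊆ K)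
    {adj : H → H → Prop} {ω : H → ℝ} (hω : ∀ b, 0 ≤ ω b)
    (hadj : ∀ a b, adj a b → b ∈ V ∧ dist a b ≤ ω b) {x₀ : H} (hx₀ : x₀ ∈ V)
    (hconn : ∀ x ∈ V, Relation.ReflTransGen adj x₀ x) :
    ∃ f, IsTour f K (V : Set H) (2 * ∑ b ∈ V, ω b) := by
  have hne : (V.powerset.filter fun S => x₀ ∈ S ∧
      ∃ f, IsTour f K {z | z ∈ S} (2 * ∑ b ∈ S, ω b)).Nonempty := by
    refine ⟨{x₀}, Finset.mem_filter.2 ⟨by simpa using hx₀, by simp, fun _ => x₀, ?_, ?_, ?_⟩⟩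
    · exact LipschitzWith.const' x₀ |>.weaken zero_le_one
    · exact fun _ => hV hx₀
    · intro v hv
      refine ⟨0, ⟨le_rfl, ?_⟩, ?_⟩
      · simpa using hω x₀
      · exact (Finset.mem_singleton.1 hv).symm
  obtain ⟨S, hS, hmax⟩ := Finset.exists_max_image _ Finset.card hne
  obtain ⟨hSV, hxS, f, hf⟩ := Finset.mem_filter.1 hS
  rw [Finset.mem_powerset] at hSV
  by_cases hall : V ⊆ S
  · rw [Finset.Subset.antisymm hall hSV]
    exact ⟨f, hf⟩
  obtain ⟨x, hxV, hxS'⟩ := Finset.not_subset.1 hall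
  obtain ⟨a, ha, b, hb, hab⟩ := exists_crossing_of_reflTransGen (hconn x hxV)
    (S := {z | z ∈ S}) hxS hxS'
  obtain ⟨hbV, hd⟩ := hadj a b hab
  obtain ⟨f', hf'⟩ := hf.exists_insert hK ha (hV hbV) hd
  have hb' : b ∉ S := hb
  have := hmax (insert b S) (Finset.mem_filter.2 ⟨?_, ?_, f', ?_⟩)
  · rw [Finset.card_insert_of_notMem hb'] at this
    omega
  · rw [Finset.mem_powerset]
    exact Finset.insert_subset hbV hSV
  · exact Finset.mem_insert_of_mem hxS
  · rw [Finset.sum_insert hb']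
    exact hf'.mono (fun z hz => Finset.mem_insert.1 hz) (by linarith)

end Tours

section NetTour

variable {H : Type u} [NormedAddCommGroup H] [NormedSpace ℝ H]

/-- The points of the `n`-th charted net can be visited by a tour whose length is controlled by the
initial scale and the gauges of all levels up to `n`. -/
theorem exists_isTour_of_chartedNet {E K : Set H} {X : ℕ → Finset H} {r : ℝ} {g : ℕ → H → ℝ}
    {t : ℕ → H → H → ℝ} (hX : ∀ k, ChartedNet E (X k) (r / 2 ^ k) (g k) (t k))
    (hmono : ∀ k, X k ⊆ X (k + 1)) (hcov : ∀ k, ∀ y ∈ X (k + 1), ∃ x ∈ X k, dist y x ≤ r / 2 ^ k)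
    {x₀ : H} (h0 : X 0 = {x₀}) (hK : Convex ℝ K) (n : ℕ) (hXK : (X n : Set H) ⊆ K) :
    ∃ f, IsTour f K (X n : Set H) (40000000000 *
      (r + ∑ k ∈ Finset.range (n + 1), r / 2 ^ k * ∑ x ∈ X k, g k x ^ 2)) := by
  set N : ℕ → Finset H := fun k =>
    ChartedNet.nearBad (X (k + 1)) (r / 2 ^ (k + 1)) (g (k + 1)) (t (k + 1)) with hN
  have hpos : ∀ k, 0 < r / 2 ^ k := fun k => (hX k).pos
  have hX' : Monotone X := monotone_nat_of_le_succ hmono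
  have hNX : ∀ k < n, N k ⊆ X n := fun k hk =>
    (Finset.filter_subset _ _).trans (hX' (by omega))
  set ω : H → ℝ := fun b =>
    (∑ k ∈ Finset.range n, if b ∈ N k then 18 * (r / 2 ^ (k + 1)) else 0) + 9 * (r / 2 ^ n) with hω
  have hterm : ∀ k b, 0 ≤ if b ∈ N k then 18 * (r / 2 ^ (k + 1)) else 0 := fun k b => by
    have := hpos (k + 1)
    split_ifs <;> positivity
  have hω0 : ∀ b, 0 ≤ ω b := fun b =>
    add_nonneg (Finset.sum_nonneg fun k _ => hterm k b) (by have := hpos n; positivity)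
  have hadj : ∀ a b, netAdj X r g t n a b → b ∈ X n ∧ dist a b ≤ ω b := by
    rintro a b (⟨k, hk, -, hb, hd⟩ | ⟨-, hb, hd⟩)
    · refine ⟨hNX k hk hb, ?_⟩
      have h1 := Finset.single_le_sum (f := fun k => if b ∈ N k then 18 * (r / 2 ^ (k + 1)) else 0)
        (fun k _ => hterm k b) (Finset.mem_range.2 hk)
      have hb' : b ∈ N k := hb
      simp only [if_pos hb'] at h1
      have := hpos n
      simp only [hω]
      linarith
    · refine ⟨hb, hd.trans ?_⟩
      simp only [hω]
      linarith [Finset.sum_nonneg fun k (_ : k ∈ Finset.range n) => hterm k b]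
  obtain ⟨f, hf⟩ := exists_isTour hK hXK hω0 hadj
    (hX' (Nat.zero_le n) (by rw [h0]; simp : x₀ ∈ X 0))
    fun x hx => reflTransGen_netAdj hX hmono hcov h0 n hx
  refine ⟨f, hf.mono subset_rfl ?_⟩
  have hsum : ∑ b ∈ X n, ω b =
      18 * ∑ k ∈ Finset.range n, r / 2 ^ (k + 1) * (N k).card + 9 * (r / 2 ^ n * (X n).card) := by
    rw [hω, Finset.sum_add_distrib, Finset.sum_comm, Finset.sum_const, nsmul_eq_mul,
      Finset.mul_sum]
    congr 1
    · refine Finset.sum_congr rfl fun k hk => ?_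
      rw [← Finset.sum_filter, Finset.filter_mem_eq_inter,
        Finset.inter_eq_right.2 (hNX k (Finset.mem_range.1 hk)), Finset.sum_const, nsmul_eq_mul]
      ring
    · ring
  have hle : ∑ k ∈ Finset.range n, r / 2 ^ (k + 1) * ((N k).card : ℝ) ≤
      104 * ∑ k ∈ Finset.range n, r / 2 ^ (k + 1) *
        ((badPoints (X (k + 1)) (r / 2 ^ (k + 1)) (g (k + 1)) (t (k + 1))).card : ℝ) := by
    rw [Finset.mul_sum]
    refine Finset.sum_le_sum fun k _ => ?_
    have : ((N k).card : ℝ) ≤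
        ((104 * (badPoints (X (k + 1)) (r / 2 ^ (k + 1)) (g (k + 1)) (t (k + 1))).card : ℕ) : ℝ) :=
      Nat.cast_le.2 (hX (k + 1)).card_nearBad_le
    rw [Nat.cast_mul, Nat.cast_ofNat] at this
    nlinarith [hpos (k + 1)]
  have h1 := sum_card_badPoints_le hX hmono hcov (by rw [h0]; simp) n
  have h2 : 0 ≤ ∑ k ∈ Finset.range (n + 1), r / 2 ^ k * ∑ x ∈ X k, g k x ^ 2 :=
    Finset.sum_nonneg fun k _ => mul_nonneg (hpos k).le (Finset.sum_nonneg fun x _ => sq_nonneg _)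
  have h3 := hpos 0
  rw [pow_zero, div_one] at h3
  have h4 : 0 ≤ r / 2 ^ n * ((X n).card : ℝ) := mul_nonneg (hpos n).le (Nat.cast_nonneg _)
  rw [hsum]
  linarith

end NetTour

section Beta

variable {H : Type u} [NormedAddCommGroup H] [InnerProductSpace ℝ H]

/-- Points close to a common line are almost isometrically parametrized by the coordinate in the
direction of the line. -/
theorem exists_nearIso_of_dist_line_le {B : Set H} {a v : H} (hv : v ≠ 0) {δ : ℝ}
    (hB : ∀ z ∈ B, ∃ p ∈ lineThrough a v, dist z p ≤ δ) : ∃ t, NearIso B t (2 * δ) := by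
  set e : H := (‖v‖⁻¹ : ℝ) • v with he
  have hv0 : ‖v‖ ≠ 0 := norm_ne_zero_iff.2 hv
  have he1 : ‖e‖ = 1 := by
    rw [he, norm_smul, norm_inv, norm_norm, inv_mul_cancel₀ hv0]
  have hve : v = ‖v‖ • e := by rw [he, smul_inv_smul₀ hv0]
  refine ⟨fun z => inner ℝ e z, fun z hz w hw => ?_⟩
  simp only [← inner_sub_right]
  obtain ⟨p, ⟨τ, rfl⟩, hp⟩ := hB z hz
  obtain ⟨q, ⟨τ', rfl⟩, hq⟩ := hB w hw
  rw [dist_eq_norm] at hp hq ⊢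
  refine ⟨?_, ?_⟩
  · simpa [he1] using abs_real_inner_le_norm e (z - w)
  set m := (z - (a + τ • v)) - (w - (a + τ' • v)) with hm
  have hmn : ‖m‖ ≤ 2 * δ := (norm_sub_le _ _).trans (by linarith)
  have hzw : z - w = ((τ - τ') * ‖v‖) • e + m := by
    rw [mul_smul, ← hve, hm, sub_smul]
    abel
  have hee : inner ℝ e e = 1 := by rw [real_inner_self_eq_norm_sq, he1, one_pow]
  clear_value e
  rw [hzw, norm_add_sq_real, inner_add_right, real_inner_smul_right, real_inner_smul_left, hee,
    norm_smul, he1, mul_one, mul_one, Real.norm_eq_abs, sq_abs]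
  have : ‖m‖ ^ 2 ≤ (2 * δ) ^ 2 := pow_le_pow_left₀ (norm_nonneg _) hmn 2
  nlinarith [sq_nonneg (inner ℝ e m)]

theorem exists_nearIso_of_jonesBeta_lt {E : Set H} {x : H} {ρ b : ℝ} [Nontrivial H] (hρ : 0 < ρ)
    (hx : x ∈ E) (hb : jonesBeta E (closedBall x ρ) < b) :
    ∃ t, NearIso (E ∩ closedBall x ρ) t (4 * b * ρ) := by
  have hne : (E ∩ closedBall x ρ).Nonempty := ⟨x, hx, mem_closedBall_self hρ.le⟩
  rw [jonesBeta, if_neg hne.ne_empty] at hb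
  obtain ⟨v₀, hv₀⟩ := exists_ne (0 : H)
  obtain ⟨_, ⟨a, v, hv, rfl⟩, hlt⟩ := exists_lt_of_csInf_lt (by exact ⟨_, x, v₀, hv₀, rfl⟩) hb
  have hdiam : Metric.diam (closedBall x ρ) = 2 * ρ := diam_closedBall_eq x hρ.le
  rw [hdiam] at hlt
  have hmem : a ∈ lineThrough a v := ⟨0, by simp⟩
  have hbdd :
      BddAbove ((fun x => infDist x (lineThrough a v) / (2 * ρ)) '' (E ∩ closedBall x ρ)) := by
    refine ⟨(ρ + dist x a) / (2 * ρ), ?_⟩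
    rintro _ ⟨z, ⟨-, hz⟩, rfl⟩
    dsimp only
    gcongr
    exact (infDist_le_dist_of_mem hmem).trans
      ((dist_triangle z x a).trans (by linarith [mem_closedBall.1 hz]))
  have := exists_nearIso_of_dist_line_le (B := E ∩ closedBall x ρ) (δ := 2 * b * ρ) hv
    fun z hz => by
    have h1 : infDist z (lineThrough a v) / (2 * ρ) < b :=
      (le_csSup hbdd ⟨z, hz, rfl⟩).trans_lt hlt
    rw [div_lt_iff₀ (by positivity)] at h1
    obtain ⟨p, hp, hd⟩ := (infDist_lt_iff ⟨a, hmem⟩).1 h1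
    exact ⟨p, hp, by linarith⟩
  rwa [show 4 * b * ρ = 2 * (2 * b * ρ) by ring]

end Beta

section Nets

variable {H : Type u} [NormedAddCommGroup H] [InnerProductSpace ℝ H]

/-- Finiteness of one level of a multiresolution family passes to the next level. -/
theorem IsMultiresolution.finite_succ [Nontrivial H] {E : Set H} {net : ℤ → Set H} {A : ℝ}
    (hA : 240 ≤ A) (hnet : IsMultiresolution E net) (hS : betaSum E net A 2 ≠ ⊤) {k : ℤ}
    (hk : (net k).Finite) : (net (k + 1)).Finite := by
  obtain ⟨⟨hsub, hmono, hsep⟩, hcov⟩ := hnet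
  set s : ℝ := (2 : ℝ) ^ (-(k + 1)) with hs
  have hs0 : 0 < s := by positivity
  have hks : (2 : ℝ) ^ (-k) = 2 * s := by
    rw [hs, show -k = -(k + 1) + 1 by ring, zpow_add_one₀ two_ne_zero, mul_comm]
  have hA0 : 0 < A := by linarith
  set ε : ℝ := 1 / (800 * A) with hε
  have hε0 : 0 < ε := by positivity
  set flat : Set H := {y | y ∈ net (k + 1) ∧ jonesBeta E (closedBall y (A * s)) < ε} with hflat
  set curved : Set H := {y | y ∈ net (k + 1) ∧ ε ≤ jonesBeta E (closedBall y (A * s))} with hcurved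
  have hsplit : net (k + 1) ⊆ flat ∪ curved := fun y hy => by
    rcases lt_or_ge (jonesBeta E (closedBall y (A * s))) ε with h | h
    · exact Or.inl ⟨hy, h⟩
    · exact Or.inr ⟨hy, h⟩
  refine Set.Finite.subset (Set.Finite.union ?_ ?_) hsplit
  · have hcover : flat ⊆ ⋃ x ∈ net k, {y | y ∈ flat ∧ dist y x ≤ 2 * s} := by
      intro y hy
      obtain ⟨x, hx, hd⟩ := hcov k y (hsub _ hy.1)
      exact Set.mem_biUnion hx ⟨hy, by rwa [← hks]⟩
    refine Set.Finite.subset (hk.biUnion fun x _ => ?_) hcover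
    rcases Set.eq_empty_or_nonempty {y | y ∈ flat ∧ dist y x ≤ 2 * s} with h | ⟨y, hy⟩
    · rw [h]; exact Set.finite_empty
    obtain ⟨t, ht⟩ := exists_nearIso_of_jonesBeta_lt (ρ := A * s) (by positivity)
      (hsub _ hy.1.1) hy.1.2
    have hclose : ∀ z ∈ {y | y ∈ flat ∧ dist y x ≤ 2 * s}, dist z y ≤ 4 * s := fun z hz => by
      linarith [dist_triangle_right z y x, hz.2, hy.2]
    refine ((ht.mono (B' := {y | y ∈ flat ∧ dist y x ≤ 2 * s}) fun z hz =>
      ⟨hsub _ hz.1.1, ?_⟩).card_le (s := s) (by positivity) hs0 ?_ ?_ hy ?_).1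
    · exact mem_closedBall.2 ((hclose z hz).trans (by nlinarith))
    · rw [hε]; field_simp; norm_num
    · exact fun z hz w hw hne => hsep _ z hz.1.1 w hw.1.1 hne
    · exact fun z hz => (hclose z hz).trans (by linarith)
  · have hsum : ∑' x : net (k + 1), ENNReal.ofReal
        (jonesBeta E (closedBall (x : H) (A * s)) ^ (2 : ℝ) *
          Metric.diam (closedBall (x : H) (A * s))) ≠ ⊤ :=
      ne_top_of_le_ne_top hS (ENNReal.le_tsum (f := fun k : ℤ => ∑' x : net k, ENNReal.ofReal
        (jonesBeta E (closedBall (x : H) (A * (2 : ℝ) ^ (-k))) ^ (2 : ℝ) *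
          Metric.diam (closedBall (x : H) (A * (2 : ℝ) ^ (-k))))) (k + 1))
    have hfin := ENNReal.finite_const_le_of_tsum_ne_top hsum
      (ε := ENNReal.ofReal (ε ^ 2 * (2 * (A * s)))) (by
        rw [Ne, ENNReal.ofReal_eq_zero, not_le]; positivity)
    refine (hfin.image Subtype.val).subset fun y hy => ⟨⟨y, hy.1⟩, ?_, rfl⟩
    have h1 : ε ^ 2 ≤ jonesBeta E (closedBall y (A * s)) ^ 2 := pow_le_pow_left₀ hε0.le hy.2 2
    simp only [Set.mem_ofPred_eq, Real.rpow_two]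
    rw [diam_closedBall_eq y (by positivity)]
    gcongr

/-- Finite partial sums of the beta numbers are bounded by the total sum. -/
theorem sum_sq_jonesBeta_le [Nontrivial H] {E : Set H} {net : ℤ → Set H} {A : ℝ} (hA : 0 < A)
    (hS : betaSum E net A 2 ≠ ⊤) (m : ℤ) (n : ℕ) (X : ℕ → Finset H)
    (hX : ∀ j, (X j : Set H) ⊆ net (m + j)) :
    ∑ j ∈ Finset.range n, (2 : ℝ) ^ (-(m + j)) *
      ∑ x ∈ X j, jonesBeta E (closedBall x (A * (2 : ℝ) ^ (-(m + j)))) ^ 2 ≤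
      (betaSum E net A 2).toReal / (2 * A) := by
  rw [le_div_iff₀ (by positivity), ← ENNReal.ofReal_le_iff_le_toReal hS, Finset.sum_mul,
    ENNReal.ofReal_sum_of_nonneg]
  swap
  · intro j _
    have := Finset.sum_nonneg fun x (_ : x ∈ X j) =>
      sq_nonneg (jonesBeta E (closedBall x (A * (2 : ℝ) ^ (-(m + j)))))
    positivity
  have hlevel : ∀ j : ℕ, ENNReal.ofReal ((2 : ℝ) ^ (-(m + j)) *
      (∑ x ∈ X j, jonesBeta E (closedBall x (A * (2 : ℝ) ^ (-(m + j)))) ^ 2) * (2 * A)) ≤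
      ∑' x : net (m + j), ENNReal.ofReal
        (jonesBeta E (closedBall (x : H) (A * (2 : ℝ) ^ (-(m + j)))) ^ (2 : ℝ) *
          Metric.diam (closedBall (x : H) (A * (2 : ℝ) ^ (-(m + j))))) := by
    intro j
    rw [Finset.mul_sum, Finset.sum_mul, ENNReal.ofReal_sum_of_nonneg fun x _ => by positivity]
    rw [← Finset.sum_attach]
    refine le_trans (le_of_eq ?_) (ENNReal.sum_le_tsum ((X j).attach.map
      ⟨fun x => (⟨x.1, hX j x.2⟩ : net (m + j)), fun x y h => Subtype.ext (by simpa using h)⟩))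
    rw [Finset.sum_map]
    refine Finset.sum_congr rfl fun x _ => ?_
    change _ = ENNReal.ofReal
      (jonesBeta E (closedBall (x : H) (A * (2 : ℝ) ^ (-(m + j : ℤ)))) ^ (2 : ℝ) *
        Metric.diam (closedBall (x : H) (A * (2 : ℝ) ^ (-(m + j : ℤ)))))
    rw [Real.rpow_two]
    rw [diam_closedBall_eq _ (by positivity)]
    ring_nf
  refine (Finset.sum_le_sum fun j _ => hlevel j).trans ?_
  refine le_trans (le_of_eq ?_) (ENNReal.sum_le_tsum ((Finset.range n).map
    ⟨fun j : ℕ => m + j, fun i j h => by simpa using h⟩))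
  rw [Finset.sum_map]
  rfl

end Nets

section NetTours

variable {H : Type u} [NormedAddCommGroup H] [InnerProductSpace ℝ H]

theorem exists_pos_mul_le {D : ℝ} (hD : 0 < D) (T : ℝ) : ∃ η : ℝ, 0 < η ∧ η * T ≤ D := by
  refine ⟨D / (|T| + 1), by positivity, ?_⟩
  rw [div_mul_eq_mul_div, div_le_iff₀ (by positivity)]
  exact mul_le_mul_of_nonneg_left ((le_abs_self T).trans (lt_add_one _).le) hD.le

/-- The levels of a multiresolution family from the scale of the diameter of the set on are finite
and admit tours of uniformly bounded length. -/
theorem exists_isTour_net {A : ℝ} (hA : 240 ≤ A) {E K : Set H} {net : ℤ → Set H}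
    (hE : E.Nontrivial) (hEb : IsBounded E) (hnet : IsMultiresolution E net)
    (hS : betaSum E net A 2 ≠ ⊤) (hK : Convex ℝ K) (hEK : E ⊆ K) :
    ∃ m : ℤ, (∀ j : ℕ, (net (m + j)).Finite) ∧ ∀ n : ℕ, ∃ f, IsTour f K (net (m + n))
      (40000000000 * (2 + 16 * A ^ 2) * (Metric.diam E + (betaSum E net A 2).toReal)) := by
  have hnt : Nontrivial H := by
    obtain ⟨a, -, b, -, hab⟩ := hE
    exact ⟨a, b, hab⟩
  have hfinsucc : ∀ k, (net k).Finite → (net (k + 1)).Finite :=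
    fun k hk => hnet.finite_succ hA hS hk
  obtain ⟨⟨hsub, hmono, hsep⟩, hcov⟩ := hnet
  have hA0 : 0 < A := by linarith
  obtain ⟨a, ha, b, hb, hab⟩ := hE
  have hD : 0 < Metric.diam E := (dist_pos.2 hab).trans_le (dist_le_diam_of_mem hEb ha hb)
  obtain ⟨l, hl1, hl2⟩ := exists_mem_Ico_zpow hD (one_lt_two (α := ℝ))
  set m : ℤ := -(l + 1) with hm
  set r : ℝ := (2 : ℝ) ^ (l + 1) with hr
  have hr0 : 0 < r := by positivity
  have hr2 : r ≤ 2 * Metric.diam E := by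
    rw [hr, zpow_add_one₀ two_ne_zero]; linarith
  have hrj : ∀ j : ℕ, (2 : ℝ) ^ (-(m + j)) = r / 2 ^ j := fun j => by
    rw [hm, hr, show -(-(l + 1) + (j : ℤ)) = (l + 1) - j by ring, zpow_sub₀ two_ne_zero,
      zpow_natCast]
  obtain ⟨x₀, hx₀, -⟩ := hcov m a ha
  have hzero : net m = {x₀} := by
    refine Set.eq_singleton_iff_unique_mem.2 ⟨hx₀, fun y hy => ?_⟩
    by_contra hne
    have h1 := hsep m y hy x₀ hx₀ hne
    have h2 := dist_le_diam_of_mem hEb (hsub _ hy) (hsub _ hx₀)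
    rw [hm, neg_neg] at h1
    linarith
  have hfin : ∀ j : ℕ, (net (m + j)).Finite := by
    intro j
    induction j with
    | zero => simp [hzero]
    | succ j ih =>
      have := hfinsucc (m + j) ih
      rwa [add_assoc, ← Nat.cast_succ] at this
  refine ⟨m, hfin, fun n => ?_⟩
  set X : ℕ → Finset H := fun j => (hfin j).toFinset with hX
  have hXmem : ∀ {j x}, x ∈ X j ↔ x ∈ net (m + j) := fun {j x} => (hfin j).mem_toFinset
  set β : ℕ → H → ℝ := fun j x => jonesBeta E (closedBall x (A * (2 : ℝ) ^ (-(m + j)))) with hβ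
  obtain ⟨η, hη0, hη⟩ := exists_pos_mul_le hD
    (∑ j ∈ Finset.range (n + 1), r / 2 ^ j * ((X j).card : ℝ))
  set g : ℕ → H → ℝ := fun j x => 4 * A * √(β j x ^ 2 + η) with hg
  have hchart : ∀ j x, ∃ t, x ∈ X j → NearIso (E ∩ closedBall x (100 * (r / 2 ^ j))) t
      (g j x * (r / 2 ^ j)) := by
    intro j x
    by_cases hx : x ∈ X j
    · have hlt : β j x < √(β j x ^ 2 + η) := Real.lt_sqrt_of_sq_lt (by linarith)
      have hp : 0 < r / 2 ^ j := by positivity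
      obtain ⟨t, ht⟩ := exists_nearIso_of_jonesBeta_lt (by positivity) (hsub _ (hXmem.1 hx)) hlt
      rw [hrj] at ht
      refine ⟨t, fun _ => ?_⟩
      rw [show g j x * (r / 2 ^ j) = 4 * √(β j x ^ 2 + η) * (A * (r / 2 ^ j)) by
        simp only [hg]; ring]
      exact ht.mono (Set.inter_subset_inter_right _ (closedBall_subset_closedBall
        (mul_le_mul_of_nonneg_right (by linarith) hp.le)))
    · exact ⟨fun _ => 0, fun h => absurd h hx⟩
  choose t ht using hchart
  have hXnet : ∀ j, ChartedNet E (X j) (r / 2 ^ j) (g j) (t j) := fun j =>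
    { pos := by positivity
      mem := fun x hx => hsub _ (hXmem.1 hx)
      sep := fun x hx y hy hne => hrj j ▸ hsep _ x (hXmem.1 hx) y (hXmem.1 hy) hne
      nonneg := fun x => by positivity
      chart := fun x hx _ => ht j x hx }
  obtain ⟨f, hf⟩ := exists_isTour_of_chartedNet hXnet (x₀ := x₀)
    (fun j x hx => hXmem.2 (by
      have := hmono _ (hXmem.1 hx)
      rwa [add_assoc, ← Nat.cast_succ] at this))
    (fun j y hy => by
      obtain ⟨x, hx, hd⟩ := hcov (m + j) y (hsub _ (hXmem.1 hy))
      exact ⟨x, hXmem.2 hx, hrj j ▸ hd⟩)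
    (by ext x; rw [hXmem]; simp [hzero]) hK n fun x hx => hEK (hsub _ (hXmem.1 hx))
  rw [(hfin n).coe_toFinset] at hf
  refine ⟨f, hf.mono subset_rfl ?_⟩
  have hβsum := sum_sq_jonesBeta_le hA0 hS m (n + 1) X fun j x hx => hXmem.1 hx
  simp only [hrj] at hβsum
  set B := (betaSum E net A 2).toReal with hB
  have hB0 : 0 ≤ B := ENNReal.toReal_nonneg
  have hgsum : ∑ j ∈ Finset.range (n + 1), r / 2 ^ j * ∑ x ∈ X j, g j x ^ 2 =
      16 * A ^ 2 * (∑ j ∈ Finset.range (n + 1), r / 2 ^ j * ∑ x ∈ X j, β j x ^ 2 +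
        η * ∑ j ∈ Finset.range (n + 1), r / 2 ^ j * (X j).card) := by
    rw [Finset.mul_sum, ← Finset.sum_add_distrib, Finset.mul_sum]
    refine Finset.sum_congr rfl fun j _ => ?_
    have : ∀ x ∈ X j, g j x ^ 2 = 16 * A ^ 2 * (β j x ^ 2 + η) := fun x _ => by
      simp only [hg]
      rw [mul_pow, Real.sq_sqrt (by positivity)]
      ring
    rw [Finset.sum_congr rfl this, ← Finset.mul_sum, Finset.sum_add_distrib, Finset.sum_const,
      nsmul_eq_mul]
    ring
  simp only [hβ, hrj] at hgsum
  have hBA : 16 * A ^ 2 * (B / (2 * A)) ≤ 16 * A ^ 2 * B := by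
    gcongr
    exact div_le_self hB0 (by linarith)
  have hA2 : 0 < 16 * A ^ 2 := by positivity
  have := mul_le_mul_of_nonneg_left (add_le_add hβsum hη) hA2.le
  rw [← hgsum, mul_add] at this
  rw [mul_assoc]
  gcongr
  linarith

end NetTours

section Limit

/-- A limit of tours of increasing sets inside a compact set visits all of their points. -/
theorem IsTour.exists_iUnion {H : Type u} [NormedAddCommGroup H] {K : Set H} (hK : IsCompact K)
    {S : ℕ → Set H} (hS : Monotone S) {L : ℝ} (h : ∀ n, ∃ f, IsTour f K (S n) L) :
    ∃ f, IsTour f K (⋃ n, S n) L := by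
  choose f hf using h
  have hlim : ∀ τ, ∃ y ∈ K, Filter.Tendsto (fun n => f n τ)
      (Filter.hyperfilter ℕ : Filter ℕ) (nhds y) := fun τ =>
    hK.ultrafilter_le_nhds ((Filter.hyperfilter ℕ).map fun n => f n τ)
      (Filter.tendsto_principal.2 (Filter.Eventually.of_forall fun n => (hf n).mem τ))
  choose F hFK hF using hlim
  refine ⟨F, LipschitzWith.of_dist_le_mul fun τ τ' => ?_, hFK, ?_⟩
  · exact le_of_tendsto ((hF τ).dist (hF τ'))
      (Filter.Eventually.of_forall fun n => (hf n).lipschitz.dist_le_mul τ τ')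
  · intro v hv
    obtain ⟨m, hm⟩ := Set.mem_iUnion.1 hv
    have hvis : ∀ n, ∃ τ ∈ Set.Icc 0 L, m ≤ n → f n τ = v := fun n => by
      by_cases hmn : m ≤ n
      · obtain ⟨τ, hτ, h⟩ := (hf n).visits v (hS hmn hm)
        exact ⟨τ, hτ, fun _ => h⟩
      · obtain ⟨τ, hτ, -⟩ := (hf m).visits v hm
        exact ⟨τ, hτ, fun h => absurd h hmn⟩
    choose τ hτ hfτ using hvis
    obtain ⟨σ, hσ, hlim⟩ := isCompact_Icc.ultrafilter_le_nhds ((Filter.hyperfilter ℕ).map τ)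
      (Filter.tendsto_principal.2 (Filter.Eventually.of_forall fun n => hτ n))
    have hlim' : Filter.Tendsto τ (Filter.hyperfilter ℕ : Filter ℕ) (nhds σ) := hlim
    refine ⟨σ, hσ, ?_⟩
    have hev : ∀ᶠ n in (Filter.hyperfilter ℕ : Filter ℕ), m ≤ n :=
      (Filter.eventually_ge_atTop m).filter_mono Nat.hyperfilter_le_atTop
    have h1 : Filter.Tendsto (fun n => dist (f n σ) v) (Filter.hyperfilter ℕ : Filter ℕ)
        (nhds (dist (F σ) v)) := (hF σ).dist tendsto_const_nhds
    have h2 : Filter.Tendsto (fun n => dist σ (τ n)) (Filter.hyperfilter ℕ : Filter ℕ)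
        (nhds (dist σ σ)) := tendsto_const_nhds.dist hlim'
    rw [dist_self] at h2
    refine dist_le_zero.1 (le_of_tendsto_of_tendsto h1 h2 (hev.mono fun n hn => ?_))
    have := (hf n).lipschitz.dist_le_mul σ (τ n)
    rwa [hfτ n hn, NNReal.coe_one, one_mul] at this

end Limit

section CompactHull

theorem exists_zpow_neg_add_lt {ε : ℝ} (hε : 0 < ε) (m : ℤ) :
    ∃ n : ℕ, (2 : ℝ) ^ (-(m + n)) < ε := by
  obtain ⟨n, hn⟩ := exists_pow_lt_of_lt_one (show 0 < ε / (2 : ℝ) ^ (-m) by positivity)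
    (show (1 / 2 : ℝ) < 1 by norm_num)
  refine ⟨n, ?_⟩
  rw [lt_div_iff₀ (by positivity)] at hn
  rwa [neg_add, zpow_add₀ two_ne_zero, mul_comm, zpow_neg _ (n : ℤ), zpow_natCast, ← inv_pow,
    ← one_div]

variable {H : Type u} [NormedAddCommGroup H]

/-- The points of a multiresolution family from some level on are dense. -/
theorem IsMultiresolution.subset_closure {E : Set H} {net : ℤ → Set H}
    (hnet : IsMultiresolution E net) (m : ℤ) : E ⊆ closure (⋃ n : ℕ, net (m + n)) := by
  intro e he
  refine Metric.mem_closure_iff.2 fun ε hε => ?_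
  obtain ⟨n, hn⟩ := exists_zpow_neg_add_lt hε m
  obtain ⟨x, hx, hd⟩ := hnet.2 (m + n) e he
  exact ⟨x, Set.mem_iUnion.2 ⟨n, hx⟩, hd.trans_lt hn⟩

/-- A set with a multiresolution family of finite levels is totally bounded. -/
theorem IsMultiresolution.totallyBounded {E : Set H} {net : ℤ → Set H}
    (hnet : IsMultiresolution E net) {m : ℤ} (hfin : ∀ n : ℕ, (net (m + n)).Finite) :
    TotallyBounded E := by
  refine Metric.totallyBounded_iff.2 fun ε hε => ?_
  obtain ⟨n, hn⟩ := exists_zpow_neg_add_lt hε m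
  refine ⟨net (m + n), hfin n, fun e he => ?_⟩
  obtain ⟨x, hx, hd⟩ := hnet.2 (m + n) e he
  exact Set.mem_iUnion₂.2 ⟨x, hx, hd.trans_lt hn⟩

/-- A tour of a set covers its closure. -/
theorem IsTour.closure_subset {f : ℝ → H} {K S : Set H} {L : ℝ} (hf : IsTour f K S L) :
    closure S ⊆ f '' Set.Icc 0 L := by
  refine closure_minimal (fun v hv => ?_)
    (isCompact_Icc.image hf.lipschitz.continuous).isClosed
  exact hf.visits v hv

/-- A tour of finite length traces a rectifiable curve. -/
theorem IsTour.isRectifiableCurve [MeasurableSpace H] [BorelSpace H] {f : ℝ → H} {K S : Set H}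
    {L : ℝ} (hf : IsTour f K S L) (hL : 0 < L) :
    IsRectifiableCurve (f '' Set.Icc 0 L) ∧ μH[1] (f '' Set.Icc 0 L) ≤ ENNReal.ofReal L := by
  have hμ : μH[1] (f '' Set.Icc 0 L) ≤ ENNReal.ofReal L := by
    have h := hf.lipschitz.hausdorffMeasure_image_le zero_le_one (Set.Icc 0 L)
    rwa [ENNReal.coe_one, ENNReal.one_rpow, one_mul, hausdorffMeasure_real, Real.volume_Icc,
      sub_zero] at h
  refine ⟨⟨⟨fun s => f (L * s),
    (hf.lipschitz.continuous.comp (continuous_const_mul L)).continuousOn, ?_⟩,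
    hμ.trans_lt ENNReal.ofReal_lt_top⟩, hμ⟩
  have : (fun s => f (L * s)) '' Set.Icc (0 : ℝ) 1 = f '' ((fun s => L * s) '' Set.Icc 0 1) :=
    (Set.image_image f _ _).symm
  rw [this, Set.image_mul_left_Icc hL.le zero_le_one, mul_zero, mul_one]

end CompactHull

/-- Theorem 1.1(iii): sufficient condition in a Hilbert space, with exponent `p = 2`. -/
theorem statement2 (A : ℝ) (hA : 240 ≤ A) :
    ∃ C : ℝ, 0 < C ∧
      ∀ (H : Type u) [NormedAddCommGroup H] [InnerProductSpace ℝ H] [CompleteSpace H]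
        [MeasurableSpace H] [BorelSpace H] (E : Set H) (net : ℤ → Set H),
        E.Nonempty → IsBounded E → IsMultiresolution E net → SEp E net A 2 < ⊤ →
        ∃ Γ : Set H, E ⊆ Γ ∧ IsRectifiableCurve Γ ∧
          μH[1] Γ ≤ ENNReal.ofReal C * SEp E net A 2 := by
  have hC : 0 < 40000000000 * (2 + 16 * A ^ 2) := by positivity
  refine ⟨40000000000 * (2 + 16 * A ^ 2), hC, ?_⟩
  intro H _ _ _ _ _ E net hne hEb hnet hS
  rcases hne.exists_eq_singleton_or_nontrivial with ⟨x, rfl⟩ | hE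
  · have hx : μH[1] ({x} : Set H) = 0 := by
      have h := (LipschitzWith.const (α := ℝ) x).hausdorffMeasure_image_le zero_le_one {0}
      rw [Set.image_singleton] at h
      simpa using h
    refine ⟨{x}, subset_rfl, ⟨⟨fun _ => x, continuousOn_const, ?_⟩, ?_⟩, ?_⟩
    · exact ((Set.nonempty_Icc.2 zero_le_one).image_const x).symm
    · simp [hx]
    · simp [hx]
  have hB : betaSum E net A 2 ≠ ⊤ := (ENNReal.add_lt_top.1 hS).2.ne
  have hD : 0 < Metric.diam E := by
    obtain ⟨a, ha, b, hb, hab⟩ := hE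
    exact (dist_pos.2 hab).trans_le (dist_le_diam_of_mem hEb ha hb)
  obtain ⟨m, hfin, htour⟩ := exists_isTour_net (K := closure (convexHull ℝ E)) hA hE hEb hnet hB
    (convex_convexHull ℝ E).closure ((subset_convexHull ℝ E).trans subset_closure)
  have hK : IsCompact (closure (convexHull ℝ E)) :=
    (hnet.totallyBounded hfin).convexHull.closure.isCompact_of_isClosed isClosed_closure
  have hmono : Monotone fun n : ℕ => net (m + n) := monotone_nat_of_le_succ fun n => by
    have := hnet.1.2.1 (m + n)
    rwa [add_assoc, ← Nat.cast_succ] at this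
  obtain ⟨f, hf⟩ := IsTour.exists_iUnion hK hmono htour
  have hB0 : 0 ≤ (betaSum E net A 2).toReal := ENNReal.toReal_nonneg
  obtain ⟨hΓ, hμ⟩ := hf.isRectifiableCurve (by positivity)
  refine ⟨_, (hnet.subset_closure m).trans hf.closure_subset, hΓ, hμ.trans_eq ?_⟩
  rw [ENNReal.ofReal_mul hC.le, ENNReal.ofReal_add hD.le hB0, ENNReal.ofReal_toReal hB, SEp]

end
end

section
/- Let X be a finite-dimensional real normed vector space and let A ≥ 240. There exists a constant C > 0, depending only on A and X, with the following property. Let E ⊆ X be nonempty with diam E < ∞ and let G be a multiresolution family for E with inflation factor A. If S_{E,2}(G) := diam E + Σ_{Q ∈ G} β_E(Q)²·diam Q < ∞, then E is contained in a rectifiable curve Γ ⊆ X with H^1(Γ) ≤ C·S_{E,2}(G). -/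
open Metric MeasureTheory Set Bornology
open scoped ENNReal NNReal Classical

universe u

noncomputable section

section FinsetSums

lemma Finset.sum_union_le_of_nonneg {α : Type*} [DecidableEq α] (s t : Finset α) {f : α → ℝ}
    (hf : ∀ a, 0 ≤ f a) : ∑ a ∈ s ∪ t, f a ≤ ∑ a ∈ s, f a + ∑ a ∈ t, f a := by
  rw [← Finset.sum_union_inter]
  linarith [Finset.sum_nonneg fun a (_ : a ∈ s ∩ t) => hf a]

lemma Finset.sum_biUnion_le_of_nonneg {ι α : Type*} [DecidableEq α] (s : Finset ι) (t : ι → Finset α)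
    {f : α → ℝ} (hf : ∀ a, 0 ≤ f a) :
    ∑ a ∈ s.biUnion t, f a ≤ ∑ i ∈ s, ∑ a ∈ t i, f a := by
  induction s using Finset.induction_on with
  | empty => simp
  | insert i s hi ih =>
    rw [Finset.biUnion_insert, Finset.sum_insert hi]
    exact (Finset.sum_union_le_of_nonneg _ _ hf).trans (by gcongr)

end FinsetSums

section Configurations

variable {M : Type u}

/-- Two points are linked if one can pass from one to the other by jumping within the pieces of
`P` and along the bridges of `B`. -/
def Linked (P : Finset (Finset M)) (B : Finset (M × M)) : M → M → Prop :=
  Relation.EqvGen fun x y => (∃ F ∈ P, x ∈ F ∧ y ∈ F) ∨ (x, y) ∈ B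

/-- All points of `V` are linked to each other. -/
def Connects (P : Finset (Finset M)) (B : Finset (M × M)) (V : Finset M) : Prop :=
  ∀ x ∈ V, ∀ y ∈ V, Linked P B x y

lemma Linked.of_imp {P P' : Finset (Finset M)} {B B' : Finset (M × M)}
    (hP : ∀ F ∈ P, Connects P' B' F) (hB : ∀ b ∈ B, Linked P' B' b.1 b.2) {x y : M}
    (h : Linked P B x y) : Linked P' B' x y := by
  induction h with
  | rel x y h =>
    rcases h with ⟨F, hF, hx, hy⟩ | h
    · exact hP F hF x hx y hy
    · exact hB _ h
  | refl x => exact .refl x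
  | symm x y _ ih => exact .symm _ _ ih
  | trans x y z _ _ ih₁ ih₂ => exact .trans _ _ _ ih₁ ih₂

lemma Linked.mono {P P' : Finset (Finset M)} {B B' : Finset (M × M)} (hP : P ⊆ P') (hB : B ⊆ B')
    {x y : M} (h : Linked P B x y) : Linked P' B' x y :=
  h.of_imp (fun F hF _ hx _ hy => .rel _ _ (.inl ⟨F, hP hF, hx, hy⟩))
    fun _ hb => .rel _ _ (.inr (hB hb))

lemma Connects.mono {P P' : Finset (Finset M)} {B B' : Finset (M × M)} {V : Finset M}
    (hP : P ⊆ P') (hB : B ⊆ B') (h : Connects P B V) : Connects P' B' V :=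
  fun x hx y hy => (h x hx y hy).mono hP hB

variable [MetricSpace M]

/-- Pieces are charged their diameter, bridges half of their length. -/
def configCost (P : Finset (Finset M)) (B : Finset (M × M)) : ℝ :=
  ∑ F ∈ P, diam (F : Set M) + (∑ b ∈ B, dist b.1 b.2) / 2

/-- A family of pieces of `V` of diameter at most `r`, together with bridges between points
of `V`, that connects `V`. -/
structure IsConfig (V : Finset M) (r : ℝ) (P : Finset (Finset M)) (B : Finset (M × M)) : Prop where
  piece_subset : ∀ F ∈ P, F ⊆ V
  bridge_subset : B ⊆ V ×ˢ V
  diam_le : ∀ F ∈ P, diam (F : Set M) ≤ r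
  connects : Connects P B V

lemma diam_le_of_finset {F : Finset M} {r : ℝ} (hr : 0 ≤ r)
    (h : ∀ x ∈ F, ∀ y ∈ F, dist x y ≤ r) : diam (F : Set M) ≤ r :=
  diam_le_of_forall_dist_le hr fun x hx y hy => h x hx y hy

lemma dist_le_diam_of_finset {F : Finset M} {x y : M} (hx : x ∈ F) (hy : y ∈ F) :
    dist x y ≤ diam (F : Set M) :=
  dist_le_diam_of_mem F.finite_toSet.isBounded hx hy

/-- Among the configurations of a given mesh there is one of least cost. -/
lemma exists_min_config {V : Finset M} {r : ℝ} {P₀ : Finset (Finset M)} {B₀ : Finset (M × M)}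
    (h₀ : IsConfig V r P₀ B₀) :
    ∃ P B, IsConfig V r P B ∧ ∀ P' B', IsConfig V r P' B' → configCost P B ≤ configCost P' B' := by
  let S := (V.powerset.powerset ×ˢ (V ×ˢ V).powerset).filter fun c => IsConfig V r c.1 c.2
  have mem_S (P B) : (P, B) ∈ S ↔ IsConfig V r P B := by
    simp only [S, Finset.mem_filter, Finset.mem_product, Finset.mem_powerset, and_iff_right_iff_imp]
    exact fun h => ⟨fun F hF => Finset.mem_powerset.2 (h.piece_subset F hF), h.bridge_subset⟩
  obtain ⟨c, hc, hmin⟩ := S.exists_min_image (fun c => configCost c.1 c.2)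
    ⟨(P₀, B₀), (mem_S _ _).2 h₀⟩
  exact ⟨c.1, c.2, (mem_S _ _).1 hc, fun P' B' h => hmin (P', B') ((mem_S _ _).2 h)⟩

/-- Replacing some of the pieces of a configuration by other pieces and bridges that connect each
of them. -/
lemma IsConfig.replace {V : Finset M} {r r' : ℝ} {P S G : Finset (Finset M)}
    {B D : Finset (M × M)} (h : IsConfig V r P B) (hS : S ⊆ P) (hG : ∀ F ∈ G, F ⊆ V)
    (hD : D ⊆ V ×ˢ V) (hconn : ∀ F ∈ S, Connects G D F)
    (hr : ∀ F ∈ P \ S, diam (F : Set M) ≤ r') (hr' : ∀ F ∈ G, diam (F : Set M) ≤ r') :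
    IsConfig V r' (P \ S ∪ G) (B ∪ D) ∧
      configCost (P \ S ∪ G) (B ∪ D) + ∑ F ∈ S, diam (F : Set M) ≤
        configCost P B + configCost G D := by
  refine ⟨⟨fun F hF => ?_, Finset.union_subset h.bridge_subset hD, fun F hF => ?_,
    fun x hx y hy => ?_⟩, ?_⟩
  · rcases Finset.mem_union.1 hF with hF | hF
    · exact h.piece_subset F (Finset.mem_sdiff.1 hF).1
    · exact hG F hF
  · rcases Finset.mem_union.1 hF with hF | hF
    · exact hr F hF
    · exact hr' F hF
  · refine (h.connects x hx y hy).of_imp (fun F hF => ?_)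
      fun b hb => .rel _ _ (.inr (Finset.mem_union_left _ hb))
    by_cases hFS : F ∈ S
    · exact (hconn F hFS).mono Finset.subset_union_right Finset.subset_union_right
    · exact fun x hx y hy => .rel _ _
        (.inl ⟨F, Finset.mem_union_left _ (Finset.mem_sdiff.2 ⟨hF, hFS⟩), hx, hy⟩)
  · have h₁ := Finset.sum_union_le_of_nonneg (P \ S) G
      (f := fun F => diam (F : Set M)) fun _ => diam_nonneg
    have h₂ := Finset.sum_union_le_of_nonneg B D (f := fun b => dist b.1 b.2) fun _ => dist_nonneg
    have h₃ := Finset.sum_sdiff (f := fun F : Finset M => diam (F : Set M)) hS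
    simp only [configCost]
    linarith

/-- Refining some of the pieces of a configuration by configurations of these pieces. -/
lemma IsConfig.refine {V : Finset M} {r r' : ℝ} {P S : Finset (Finset M)}
    {B : Finset (M × M)} (h : IsConfig V r P B) (hS : S ⊆ P)
    (hr : ∀ F ∈ P \ S, diam (F : Set M) ≤ r') {e : Finset M → ℝ}
    (hsplit : ∀ F ∈ S, ∃ G D, IsConfig F r' G D ∧ configCost G D ≤ diam (F : Set M) + e F) :
    ∃ P' B', IsConfig V r' P' B' ∧ configCost P' B' ≤ configCost P B + ∑ F ∈ S, e F := by
  choose! G D hGD hcost using hsplit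
  have hSV (F) (hF : F ∈ S) : F ⊆ V := h.piece_subset F (hS hF)
  obtain ⟨h₁, h₂⟩ := h.replace (r' := r') hS (G := S.biUnion G) (D := S.biUnion D)
    (fun F hF => by
      obtain ⟨F', hF', hF⟩ := Finset.mem_biUnion.1 hF
      exact ((hGD F' hF').piece_subset F hF).trans (hSV F' hF'))
    (Finset.biUnion_subset.2 fun F hF => (hGD F hF).bridge_subset.trans
      (Finset.product_subset_product (hSV F hF) (hSV F hF)))
    (fun F hF => (hGD F hF).connects.mono (Finset.subset_biUnion_of_mem _ hF)
      (Finset.subset_biUnion_of_mem _ hF)) hr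
    (fun F hF => by
      obtain ⟨F', hF', hF⟩ := Finset.mem_biUnion.1 hF
      exact (hGD F' hF').diam_le F hF)
  refine ⟨_, _, h₁, ?_⟩
  have h₃ := Finset.sum_biUnion_le_of_nonneg S G
    (f := fun F => diam (F : Set M)) fun _ => diam_nonneg
  have h₄ := Finset.sum_biUnion_le_of_nonneg S D (f := fun b => dist b.1 b.2) fun _ => dist_nonneg
  have h₅ : ∑ F ∈ S, configCost (G F) (D F) ≤ ∑ F ∈ S, (diam (F : Set M) + e F) :=
    Finset.sum_le_sum hcost
  simp only [configCost, Finset.sum_add_distrib, ← Finset.sum_div] at h₂ h₅ ⊢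
  linarith

end Configurations

section Packing

variable (H : Type u) [NormedAddCommGroup H] [NormedSpace ℝ H] [FiniteDimensional ℝ H]

/-- A `δ`-separated set in a ball of radius `R δ` has boundedly many points. -/
lemma exists_packing_bound (R : ℝ) :
    ∃ N : ℕ, ∀ (s : Finset H) (y : H) (δ : ℝ), 0 < δ → (∀ x ∈ s, dist x y ≤ R * δ) →
      (∀ x ∈ s, ∀ x' ∈ s, x ≠ x' → δ < dist x x') → s.card ≤ N := by
  have : ProperSpace H := FiniteDimensional.proper ℝ H
  obtain ⟨t, -, ht, hcov⟩ :=
    (isCompact_closedBall (0 : H) R).finite_cover_balls (e := 1 / 2) (by norm_num)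
  refine ⟨ht.toFinset.card, fun s y δ hδ hs hsep => ?_⟩
  have hex (x) (hx : x ∈ s) : ∃ c ∈ t, dist (δ⁻¹ • (x - y)) c < 1 / 2 := by
    have : δ⁻¹ • (x - y) ∈ closedBall (0 : H) R := by
      rw [mem_closedBall_zero_iff, norm_smul, norm_inv, Real.norm_of_nonneg hδ.le, ← dist_eq_norm,
        inv_mul_le_iff₀ hδ, mul_comm]
      exact hs x hx
    simpa using hcov this
  choose! c hct hc using hex
  refine Finset.card_le_card_of_injOn c (fun x hx => by simpa using hct x hx) ?_
  intro x hx x' hx' hxx'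
  by_contra hne
  have h₁ := hsep x hx x' hx' hne
  have h₂ : dist (δ⁻¹ • (x - y)) (δ⁻¹ • (x' - y)) < 1 := by
    have := dist_triangle_right (δ⁻¹ • (x - y)) (δ⁻¹ • (x' - y)) (c x)
    have h₃ := hc x hx
    have h₄ := hc x' hx'
    rw [← hxx'] at h₄
    linarith
  rw [dist_smul₀, dist_sub_right, norm_inv, Real.norm_of_nonneg hδ.le, inv_mul_lt_iff₀ hδ] at h₂
  linarith

/-- A finite set in a ball of radius `R r` has a configuration of mesh `r` and cost `≲ r`. -/
lemma exists_cover_config (R : ℝ) (hR : 0 ≤ R) :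
    ∃ C : ℝ, 0 ≤ C ∧ ∀ (U : Finset H) (y : H) (r : ℝ), 0 < r → (∀ x ∈ U, dist x y ≤ R * r) →
      ∃ G D, IsConfig U r G D ∧ configCost G D ≤ C * r := by
  obtain ⟨N, hN⟩ := exists_packing_bound H (2 * R)
  refine ⟨N * (1 + R), by positivity, fun U y r hr hU => ?_⟩
  rcases U.eq_empty_or_nonempty with rfl | ⟨u₀, hu₀⟩
  · refine ⟨∅, ∅, ⟨by simp, by simp, by simp, fun x hx => by simp at hx⟩, ?_⟩
    simpa [configCost] using (by positivity : 0 ≤ N * (1 + R) * r)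
  let S := U.powerset.filter fun T => ∀ x ∈ T, ∀ x' ∈ T, x ≠ x' → r / 2 < dist x x'
  obtain ⟨T, hT, hmax⟩ := S.exists_max_image Finset.card ⟨∅, by simp [S]⟩
  obtain ⟨hTU, hsep⟩ : T ⊆ U ∧ ∀ x ∈ T, ∀ x' ∈ T, x ≠ x' → r / 2 < dist x x' := by
    simpa [S] using hT
  have hnet (u) (hu : u ∈ U) : ∃ t ∈ T, dist u t ≤ r / 2 := by
    by_contra! hfar
    have huT : u ∉ T := fun h => by
      have := hfar u h
      rw [dist_self] at this
      linarith
    have h₁ : insert u T ∈ S := by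
      simp only [S, Finset.mem_filter, Finset.mem_powerset]
      refine ⟨Finset.insert_subset hu hTU, fun x hx x' hx' hne => ?_⟩
      rcases Finset.mem_insert.1 hx with rfl | h <;> rcases Finset.mem_insert.1 hx' with rfl | h'
      · exact absurd rfl hne
      · exact hfar _ h'
      · rw [dist_comm]
        exact hfar _ h
      · exact hsep x h x' h' hne
    have := hmax _ h₁
    rw [Finset.card_insert_of_notMem huT] at this
    omega
  have hcard : T.card ≤ N := hN T y (r / 2) (by linarith)
    (fun x hx => (hU x (hTU hx)).trans_eq (by ring)) hsep
  obtain ⟨t₀, ht₀, -⟩ := hnet u₀ hu₀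
  let piece (t : H) : Finset H := U.filter fun u => dist u t ≤ r / 2
  refine ⟨T.image piece, T.image fun t => (t₀, t), ⟨?_, ?_, ?_, ?_⟩, ?_⟩
  · intro F hF
    obtain ⟨t, -, rfl⟩ := Finset.mem_image.1 hF
    exact Finset.filter_subset _ _
  · intro b hb
    obtain ⟨t, ht, rfl⟩ := Finset.mem_image.1 hb
    exact Finset.mk_mem_product (hTU ht₀) (hTU ht)
  · intro F hF
    obtain ⟨t, -, rfl⟩ := Finset.mem_image.1 hF
    refine diam_le_of_finset hr.le fun x hx x' hx' => ?_
    have h₁ := (Finset.mem_filter.1 hx).2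
    have h₂ := (Finset.mem_filter.1 hx').2
    linarith [dist_triangle_right x x' t]
  · have key (x) (hx : x ∈ U) :
        Linked (T.image piece) (T.image fun t => (t₀, t)) t₀ x := by
      obtain ⟨t, ht, hxt⟩ := hnet x hx
      refine .trans _ t _ (.rel _ _ (.inr (Finset.mem_image_of_mem _ ht))) (.rel _ _ (.inl
        ⟨piece t, Finset.mem_image_of_mem _ ht, Finset.mem_filter.2 ⟨hTU ht, ?_⟩,
          Finset.mem_filter.2 ⟨hx, hxt⟩⟩))
      rw [dist_self]
      linarith
    exact fun x hx x' hx' => (key x hx).symm.trans _ _ _ (key x' hx')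
  · have hd (t) (ht : t ∈ T) : dist t₀ t ≤ 2 * R * r := by
      have h₁ := hU _ (hTU ht₀)
      have h₂ := hU _ (hTU ht)
      linarith [dist_triangle_right t₀ t y]
    have h₁ : ∑ F ∈ T.image piece, diam (F : Set H) ≤ ∑ t ∈ T, r :=
      (Finset.sum_image_le_of_nonneg fun _ _ => diam_nonneg).trans
        (Finset.sum_le_sum fun t _ => diam_le_of_finset hr.le fun x hx x' hx' => by
          have h₁ := (Finset.mem_filter.1 hx).2
          have h₂ := (Finset.mem_filter.1 hx').2
          linarith [dist_triangle_right x x' t])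
    have h₂ : ∑ b ∈ T.image (fun t => (t₀, t)), dist b.1 b.2 ≤ ∑ t ∈ T, 2 * R * r :=
      (Finset.sum_image_le_of_nonneg fun _ _ => dist_nonneg).trans (Finset.sum_le_sum hd)
    have h₃ : (T.card : ℝ) * ((1 + R) * r) ≤ N * ((1 + R) * r) := by gcongr
    simp only [Finset.sum_const, nsmul_eq_mul] at h₁ h₂
    simp only [configCost]
    linarith

/-- In a configuration of least cost only boundedly many large pieces come near a given point. -/
lemma exists_multiplicity_bound (K : ℝ) (hK : 0 ≤ K) :
    ∃ C : ℝ, 0 ≤ C ∧ ∀ (V : Finset H) (r : ℝ) (P : Finset (Finset H)) (B : Finset (H × H)), 0 < r →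
      IsConfig V r P B →
      (∀ P' B', IsConfig V r P' B' → configCost P B ≤ configCost P' B') →
      ∀ (y : H) (S : Finset (Finset H)), S ⊆ P →
        (∀ F ∈ S, 2 / 3 * r < diam (F : Set H) ∧ ∃ p ∈ F, dist p y ≤ K * r) → S.card ≤ C := by
  obtain ⟨C, hC, hcov⟩ := exists_cover_config H (K + 1) (by positivity)
  refine ⟨3 / 2 * C, by positivity, fun V r P B hr h hmin y S hSP hS => ?_⟩
  let U := S.biUnion id
  have hUV : U ⊆ V := Finset.biUnion_subset.2 fun F hF => h.piece_subset F (hSP hF)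
  obtain ⟨G, D, hGD, hcost⟩ := hcov U y r hr fun x hx => by
    obtain ⟨F, hF, hx⟩ := Finset.mem_biUnion.1 hx
    obtain ⟨-, p, hp, hpy⟩ := hS F hF
    have h₁ := (dist_le_diam_of_finset hx hp).trans (h.diam_le F (hSP hF))
    linarith [dist_triangle x p y]
  obtain ⟨h₁, h₂⟩ := h.replace hSP (fun F hF => (hGD.piece_subset F hF).trans hUV)
    (hGD.bridge_subset.trans (Finset.product_subset_product hUV hUV))
    (fun F hF x hx x' hx' => hGD.connects x (Finset.mem_biUnion.2 ⟨F, hF, hx⟩) x'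
      (Finset.mem_biUnion.2 ⟨F, hF, hx'⟩))
    (fun F hF => h.diam_le F (Finset.mem_sdiff.1 hF).1) hGD.diam_le
  have h₃ := hmin _ _ h₁
  have h₄ : ∑ F ∈ S, 2 / 3 * r ≤ ∑ F ∈ S, diam (F : Set H) :=
    Finset.sum_le_sum fun F hF => (hS F hF).1.le
  rw [Finset.sum_const, nsmul_eq_mul] at h₄
  have h₅ : (S.card : ℝ) * r ≤ 3 / 2 * C * r := by linarith
  exact le_of_mul_le_mul_right h₅ hr

end Packing

section Splitting

variable {H : Type u} [NormedAddCommGroup H] [InnerProductSpace ℝ H]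

/-- The points of `F` are within distance `h` of a common line. -/
def NearLine (F : Finset H) (h : ℝ) : Prop :=
  ∃ a v : H, v ≠ 0 ∧ ∀ x ∈ F, ∃ y ∈ lineThrough a v, dist x y ≤ h

/-- Near a line, the coordinate along the line nearly preserves distances. -/
lemma NearLine.exists_coordinate {F : Finset H} {h : ℝ} (hF : NearLine F h) :
    ∃ f : H → ℝ, ∀ x ∈ F, ∀ y ∈ F, |f x - f y| ≤ dist x y ∧
      dist x y ^ 2 ≤ (f x - f y) ^ 2 + (2 * h) ^ 2 := by
  obtain ⟨a, v, hv, hF⟩ := hF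
  have hv' : ‖v‖ ≠ 0 := norm_ne_zero_iff.2 hv
  obtain ⟨u, hu, hvu⟩ : ∃ u : H, ‖u‖ = 1 ∧ v = ‖v‖ • u :=
    ⟨‖v‖⁻¹ • v, by simp [norm_smul, hv'], by simp [smul_smul, hv']⟩
  refine ⟨fun x => inner ℝ u x, fun x hx y hy => ?_⟩
  simp only [← inner_sub_right]
  refine ⟨?_, ?_⟩
  · have := abs_real_inner_le_norm u (x - y)
    rwa [hu, one_mul, ← dist_eq_norm] at this
  obtain ⟨_, ⟨s, rfl⟩, hs⟩ := hF x hx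
  obtain ⟨_, ⟨t, rfl⟩, ht⟩ := hF y hy
  rw [dist_eq_norm] at hs ht
  set e : H := x - (a + s • v) - (y - (a + t • v)) with he
  have he' : ‖e‖ ≤ 2 * h := (norm_sub_le _ _).trans (by linarith)
  have hxy : x - y = e + ((s - t) * ‖v‖) • u := by
    rw [mul_smul, ← hvu, he, sub_smul]
    abel
  have h₁ : ‖e‖ ^ 2 ≤ (2 * h) ^ 2 := by gcongr
  have h₂ : inner ℝ u u = (1 : ℝ) := by rw [real_inner_self_eq_norm_sq, hu, one_pow]
  rw [dist_eq_norm, hxy, norm_add_sq_real, inner_add_right, inner_smul_right, inner_smul_right, h₂,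
    norm_smul, hu, real_inner_comm, Real.norm_eq_abs, mul_one, sq_abs]
  nlinarith [sq_nonneg (inner ℝ u e)]

/-- A set that is flat compared to its diameter can be cut in two. -/
lemma exists_flat_split {M : Type u} [MetricSpace M] {F : Finset M} {k : ℝ} {f : M → ℝ}
    (hd : 0 < diam (F : Set M)) (hk : 0 ≤ k) (hkd : k ≤ diam (F : Set M) / 50)
    (hf : ∀ x ∈ F, ∀ y ∈ F, |f x - f y| ≤ dist x y ∧
      dist x y ^ 2 ≤ (f x - f y) ^ 2 + k ^ 2) :
    ∃ G D, IsConfig F (2 / 3 * diam (F : Set M)) G D ∧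
      configCost G D ≤ diam (F : Set M) + 3 * (k ^ 2 / diam (F : Set M)) := by
  set d := diam (F : Set M) with hd_def
  have hne : F.Nonempty := by
    by_contra h
    simp [Finset.not_nonempty_iff_eq_empty.1 h, d] at hd
  have hdist (x) (hx : x ∈ F) (y) (hy : y ∈ F) : dist x y ≤ |f x - f y| + k := by
    refine abs_le_of_sq_le_sq' ?_ (by positivity) |>.2
    nlinarith [(hf x hx y hy).2, sq_abs (f x - f y), abs_nonneg (f x - f y)]
  obtain ⟨a, ha, hamin⟩ := F.exists_min_image f hne
  obtain ⟨b, hb, hbmax⟩ := F.exists_max_image f hne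
  have diam_le_add (G : Finset M) (hG : G ⊆ F) (s t : ℝ) (hst : s ≤ t)
      (h : ∀ x ∈ G, s ≤ f x ∧ f x ≤ t) : diam (G : Set M) ≤ t - s + k := by
    refine diam_le_of_finset (by linarith) fun x hx y hy => ?_
    have h₁ := h x hx
    have h₂ := h y hy
    have h₃ : |f x - f y| ≤ t - s := abs_le.2 ⟨by linarith, by linarith⟩
    linarith [hdist x (hG hx) y (hG hy)]
  have diam_le_add_sq (G : Finset M) (hG : G ⊆ F) (s t : ℝ) (hst : s < t)
      (h : ∀ x ∈ G, s ≤ f x ∧ f x ≤ t) : diam (G : Set M) ≤ t - s + k ^ 2 / (2 * (t - s)) := by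
    have hpos : 0 < t - s := by linarith
    refine diam_le_of_finset (by positivity) fun x hx y hy => ?_
    have h₁ := h x hx
    have h₂ := h y hy
    have h₃ : (f x - f y) ^ 2 ≤ (t - s) ^ 2 := sq_le_sq' (by linarith) (by linarith)
    refine abs_le_of_sq_le_sq' ?_ (by positivity) |>.2
    have h₄ : 2 * (t - s) * (k ^ 2 / (2 * (t - s))) = k ^ 2 := by field_simp
    nlinarith [(hf x (hG hx) y (hG hy)).2, sq_nonneg (k ^ 2 / (2 * (t - s)))]
  set w := f b - f a with hw
  have hwd : w ≤ d := (le_abs_self _).trans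
    ((hf b hb a ha).1.trans (dist_le_diam_of_finset hb ha))
  have hdw : d ≤ w + k := diam_le_add F subset_rfl _ _ (hamin b hb)
    fun x hx => ⟨hamin x hx, hbmax x hx⟩
  let c := (f a + f b) / 2
  let F₁ := F.filter fun x => f x ≤ c
  let F₂ := F.filter fun x => c < f x
  have hF₁ : F₁ ⊆ F := Finset.filter_subset _ _
  have hF₂ : F₂ ⊆ F := Finset.filter_subset _ _
  have ha₁ : a ∈ F₁ := Finset.mem_filter.2 ⟨ha, by simp only [c]; linarith⟩
  have hb₂ : b ∈ F₂ := Finset.mem_filter.2 ⟨hb, by simp only [c]; linarith⟩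
  obtain ⟨p, hp, hpmax⟩ := F₁.exists_max_image f ⟨a, ha₁⟩
  obtain ⟨q, hq, hqmin⟩ := F₂.exists_min_image f ⟨b, hb₂⟩
  have hpc : f p ≤ c := (Finset.mem_filter.1 hp).2
  have hqc : c < f q := (Finset.mem_filter.1 hq).2
  have hap : f a ≤ f p := hamin p (hF₁ hp)
  have hqb : f q ≤ f b := hbmax q (hF₂ hq)
  have hrange₁ (x) (hx : x ∈ F₁) : f a ≤ f x ∧ f x ≤ f p := ⟨hamin x (hF₁ hx), hpmax x hx⟩
  have hrange₂ (x) (hx : x ∈ F₂) : f q ≤ f x ∧ f x ≤ f b := ⟨hqmin x hx, hbmax x (hF₂ hx)⟩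
  have hmem (x) (hx : x ∈ F) : x ∈ F₁ ∨ x ∈ F₂ :=
    (le_or_gt (f x) c).imp (fun h => Finset.mem_filter.2 ⟨hx, h⟩)
      fun h => Finset.mem_filter.2 ⟨hx, h⟩
  simp only [c] at hpc hqc
  rcases le_or_gt (f q - f p) (w / 8) with hg | hg
  · let F₃ := insert p F₂
    have hF₃ : F₃ ⊆ F := Finset.insert_subset (hF₁ hp) hF₂
    have hrange₃ (x) (hx : x ∈ F₃) : f p ≤ f x ∧ f x ≤ f b := by
      rcases Finset.mem_insert.1 hx with rfl | hx
      · exact ⟨le_rfl, by linarith⟩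
      · have := hrange₂ x hx
        exact ⟨by linarith, this.2⟩
    refine ⟨{F₁} ∪ {F₃}, ∅, ⟨?_, by simp, ?_, ?_⟩, ?_⟩
    · simp [hF₁, hF₃]
    · have h₁ := diam_le_add F₁ hF₁ _ _ hap hrange₁
      have h₃ := diam_le_add F₃ hF₃ _ _ (by linarith) hrange₃
      simp only [Finset.mem_union, Finset.mem_singleton]
      rintro G (rfl | rfl) <;> linarith
    · have key (x) (hx : x ∈ F) : Linked ({F₁} ∪ {F₃}) ∅ p x := by
        rcases hmem x hx with hx | hx
        · exact .rel _ _ (.inl ⟨F₁, by simp, hp, hx⟩)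
        · exact .rel _ _ (.inl ⟨F₃, by simp, Finset.mem_insert_self _ _,
            Finset.mem_insert_of_mem hx⟩)
      exact fun x hx y hy => (key x hx).symm.trans _ _ _ (key y hy)
    · have h₀ := Finset.sum_union_le_of_nonneg {F₁} {F₃}
        (f := fun F => diam (F : Set M)) fun _ => diam_nonneg
      have h₁ := diam_le_add_sq F₁ hF₁ (f a) (f p) (by linarith) hrange₁
      have h₃ := diam_le_add_sq F₃ hF₃ (f p) (f b) (by linarith) hrange₃
      have h₄ : k ^ 2 / (2 * (f p - f a)) ≤ 3 / 2 * (k ^ 2 / d) := by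
        calc k ^ 2 / (2 * (f p - f a)) ≤ k ^ 2 / (2 / 3 * d) :=
            div_le_div_of_nonneg_left (sq_nonneg k) (by positivity) (by linarith)
          _ = 3 / 2 * (k ^ 2 / d) := by field_simp
      have h₅ : k ^ 2 / (2 * (f b - f p)) ≤ 3 / 2 * (k ^ 2 / d) := by
        calc k ^ 2 / (2 * (f b - f p)) ≤ k ^ 2 / (2 / 3 * d) :=
            div_le_div_of_nonneg_left (sq_nonneg k) (by positivity) (by linarith)
          _ = 3 / 2 * (k ^ 2 / d) := by field_simp
      simp only [Finset.sum_singleton] at h₀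
      simp only [configCost, Finset.sum_empty]
      linarith
  · refine ⟨{F₁} ∪ {F₂}, {(p, q)}, ⟨?_, ?_, ?_, ?_⟩, ?_⟩
    · simp [hF₁, hF₂]
    · simp [hF₁ hp, hF₂ hq]
    · have h₁ := diam_le_add F₁ hF₁ _ _ hap hrange₁
      have h₂ := diam_le_add F₂ hF₂ _ _ hqb hrange₂
      simp only [Finset.mem_union, Finset.mem_singleton]
      rintro G (rfl | rfl) <;> linarith
    · have key (x) (hx : x ∈ F) : Linked ({F₁} ∪ {F₂}) {(p, q)} p x := by
        rcases hmem x hx with hx | hx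
        · exact .rel _ _ (.inl ⟨F₁, by simp, hp, hx⟩)
        · exact .trans _ q _ (.rel _ _ (.inr (by simp)))
            (.rel _ _ (.inl ⟨F₂, by simp, hq, hx⟩))
      exact fun x hx y hy => (key x hx).symm.trans _ _ _ (key y hy)
    · have h₀ := Finset.sum_union_le_of_nonneg {F₁} {F₂}
        (f := fun F => diam (F : Set M)) fun _ => diam_nonneg
      have h₁ := diam_le_add F₁ hF₁ _ _ hap hrange₁
      have h₂ := diam_le_add F₂ hF₂ _ _ hqb hrange₂
      have h₃ := hdist p (hF₁ hp) q (hF₂ hq)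
      rw [abs_of_nonpos (by linarith)] at h₃
      have h₄ : 0 ≤ k ^ 2 / d := by positivity
      simp only [Finset.sum_singleton] at h₀
      simp only [configCost, Finset.sum_singleton]
      linarith

/-- A set at distance `h` from a line can be cut up at an expense `≲ h ^ 2 / diam`. -/
lemma exists_split (H : Type u) [NormedAddCommGroup H] [InnerProductSpace ℝ H]
    [FiniteDimensional ℝ H] :
    ∃ C : ℝ, 0 ≤ C ∧ ∀ (F : Finset H) (h : ℝ), 0 < diam (F : Set H) → 0 ≤ h →
      (∀ h' > h, NearLine F h') → ∃ G D, IsConfig F (2 / 3 * diam (F : Set H)) G D ∧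
        configCost G D ≤ diam (F : Set H) + C * (h ^ 2 / diam (F : Set H)) := by
  obtain ⟨C, hC, hcov⟩ := exists_cover_config H (3 / 2) (by norm_num)
  refine ⟨10000 * C + 12, by positivity, fun F h hd hh hF => ?_⟩
  set d := diam (F : Set H)
  have hne : F.Nonempty := by
    by_contra h
    simp [Finset.not_nonempty_iff_eq_empty.1 h, d] at hd
  obtain ⟨y, hy⟩ := hne
  have key (h') (hh' : h < h') : ∃ G D, IsConfig F (2 / 3 * d) G D ∧
      configCost G D ≤ d + (10000 * C + 12) * (h' ^ 2 / d) := by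
    rcases le_or_gt (2 * h') (d / 50) with hflat | hflat
    · obtain ⟨f, hf⟩ := (hF h' hh').exists_coordinate
      obtain ⟨G, D, hGD, hcost⟩ := exists_flat_split hd (by linarith) hflat hf
      refine ⟨G, D, hGD, hcost.trans ?_⟩
      have : 0 ≤ C * (h' ^ 2 / d) := by positivity
      rw [mul_pow, mul_div_assoc]
      linarith
    · obtain ⟨G, D, hGD, hcost⟩ := hcov F y (2 / 3 * d) (by linarith) fun x hx => by
        linarith [dist_le_diam_of_finset hx hy]
      refine ⟨G, D, hGD, hcost.trans ?_⟩
      have h₁ : d ≤ 10000 * (h' ^ 2 / d) := by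
        rw [mul_div_assoc', le_div_iff₀ hd]
        nlinarith
      have h₂ : 0 ≤ h' ^ 2 / d := by positivity
      nlinarith
  obtain ⟨G₀, D₀, h₀, -⟩ := key (h + 1) (by linarith)
  obtain ⟨G, D, hGD, hmin⟩ := exists_min_config h₀
  refine ⟨G, D, hGD, ?_⟩
  have hcont : Filter.Tendsto (fun h' => d + (10000 * C + 12) * (h' ^ 2 / d)) (nhdsWithin h (Ioi h))
      (nhds (d + (10000 * C + 12) * (h ^ 2 / d))) :=
    (Continuous.tendsto (by fun_prop) h).mono_left nhdsWithin_le_nhds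
  refine ge_of_tendsto hcont (eventually_mem_nhdsWithin.mono fun h' hh' => ?_)
  obtain ⟨G', D', h', hcost⟩ := key h' hh'
  exact (hmin _ _ h').trans hcost

end Splitting

section MultiscaleConfigurations

lemma sum_toReal_le_of_card_fiber_le {α ι : Type*} (S : Finset α) (g : α → ι) {w : ι → ℝ≥0∞}
    (hw : ∑' i, w i ≠ ⊤) {m : ℝ} (hm : 0 ≤ m) (hS : ∀ i, ((S.filter fun a => g a = i).card : ℝ) ≤ m) :
    ∑ a ∈ S, (w (g a)).toReal ≤ m * (∑' i, w i).toReal := by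
  rw [← Finset.sum_fiberwise_of_maps_to fun a ha => Finset.mem_image_of_mem g ha]
  calc ∑ j ∈ S.image g, ∑ a ∈ S with g a = j, (w (g a)).toReal
      = ∑ j ∈ S.image g, ((S.filter fun a => g a = j).card : ℝ) * (w j).toReal := by
        refine Finset.sum_congr rfl fun j _ => ?_
        rw [← nsmul_eq_mul, ← Finset.sum_const]
        exact Finset.sum_congr rfl fun a ha => by rw [(Finset.mem_filter.1 ha).2]
    _ ≤ ∑ j ∈ S.image g, m * (w j).toReal := by
        gcongr with j
        exact hS j
    _ = m * (∑ j ∈ S.image g, w j).toReal := by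
        rw [← Finset.mul_sum, ENNReal.toReal_sum fun j _ => ENNReal.ne_top_of_tsum_ne_top hw j]
    _ ≤ m * (∑' i, w i).toReal := by
        gcongr
        exact ENNReal.sum_le_tsum _

variable (H : Type u) [NormedAddCommGroup H] [InnerProductSpace ℝ H] [FiniteDimensional ℝ H]

/-- Passing from mesh `r` to mesh `2 r / 3` at an expense controlled by the deviation from lines
at scale `s ≈ r`. -/
lemma exists_finer_config (K : ℝ) (hK : 0 ≤ K) :
    ∃ C : ℝ, 0 ≤ C ∧ ∀ (V : Finset H) (r s c : ℝ), 0 < r → 0 < s → s ≤ 2 * r →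
      (∃ P B, IsConfig V r P B ∧ configCost P B ≤ c) →
      ∀ {ι : Type*} (y : ι → H) (w : ι → ℝ≥0∞), ∑' i, w i ≠ ⊤ →
      (∀ F ⊆ V, 0 < diam (F : Set H) → diam (F : Set H) ≤ r →
        ∃ i, (∃ p ∈ F, dist p (y i) ≤ K * s) ∧
          ∃ h, 0 ≤ h ∧ ENNReal.ofReal (h ^ 2 / s) ≤ w i ∧ ∀ h' > h, NearLine F h') →
      ∃ P B, IsConfig V (2 / 3 * r) P B ∧ configCost P B ≤ c + C * (∑' i, w i).toReal := by
  obtain ⟨C, hC, hsplit⟩ := exists_split H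
  obtain ⟨m, hm, hmult⟩ := exists_multiplicity_bound H (2 * K) (by positivity)
  refine ⟨3 * C * m, by positivity, fun V r s c hr hs hsr hconfig ι y w hw hflat => ?_⟩
  obtain ⟨P₀, B₀, h₀, hc⟩ := hconfig
  obtain ⟨P, B, hPB, hmin⟩ := exists_min_config h₀
  let S : Finset (Finset H) := P.filter fun F : Finset H => 2 / 3 * r < diam (F : Set H)
  have hSP : S ⊆ P := Finset.filter_subset _ _
  have hS (F) (hF : F ∈ S) : 2 / 3 * r < diam (F : Set H) := (Finset.mem_filter.1 hF).2
  have hPS (F) (hF : F ∈ P \ S) : diam (F : Set H) ≤ 2 / 3 * r := by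
    obtain ⟨hFP, hFS⟩ := Finset.mem_sdiff.1 hF
    exact not_lt.1 fun h => hFS (Finset.mem_filter.2 ⟨hFP, h⟩)
  have hex (F) (hF : F ∈ S) : ∃ i, (∃ p ∈ F, dist p (y i) ≤ K * s) ∧
      ∃ h, 0 ≤ h ∧ ENNReal.ofReal (h ^ 2 / s) ≤ w i ∧ ∀ h' > h, NearLine F h' :=
    hflat F (hPB.piece_subset F (hSP hF)) (by linarith [hS F hF]) (hPB.diam_le F (hSP hF))
  have hcost : configCost P B ≤ c := (hmin _ _ h₀).trans hc
  rcases S.eq_empty_or_nonempty with hSe | ⟨F₀, hF₀⟩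
  · refine ⟨P, B, ⟨hPB.piece_subset, hPB.bridge_subset, fun F hF => hPS F (by simp [hSe, hF]),
      hPB.connects⟩, hcost.trans (le_add_of_nonneg_right (by positivity))⟩
  have : Nonempty ι := ⟨(hex F₀ hF₀).choose⟩
  choose! i hnear h hh hhw hline using hex
  obtain ⟨P', B', hPB', hcost'⟩ := hPB.refine (r' := 2 / 3 * r) hSP hPS
    (e := fun F => 3 * C * (w (i F)).toReal) fun F hF => by
      have hdr := hPB.diam_le F (hSP hF)
      have hd : 0 < diam (F : Set H) := by linarith [hS F hF]
      obtain ⟨G, D, hGD, hGDcost⟩ := hsplit F (h F) hd (hh F hF) (hline F hF)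
      refine ⟨G, D, ⟨hGD.piece_subset, hGD.bridge_subset,
        fun F' hF' => (hGD.diam_le F' hF').trans (by linarith), hGD.connects⟩, hGDcost.trans ?_⟩
      have h₁ : h F ^ 2 / s ≤ (w (i F)).toReal :=
        (ENNReal.ofReal_le_iff_le_toReal (ENNReal.ne_top_of_tsum_ne_top hw _)).1 (hhw F hF)
      have h₂ : h F ^ 2 / diam (F : Set H) ≤ 3 * (h F ^ 2 / s) := by
        calc h F ^ 2 / diam (F : Set H) ≤ h F ^ 2 / (s / 3) :=
              div_le_div_of_nonneg_left (sq_nonneg _) (by positivity) (by linarith [hS F hF])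
          _ = 3 * (h F ^ 2 / s) := by field_simp
      have h₃ := mul_le_mul_of_nonneg_left (h₂.trans (mul_le_mul_of_nonneg_left h₁ zero_le_three)) hC
      linarith
  refine ⟨P', B', hPB', hcost'.trans ?_⟩
  have hsum := sum_toReal_le_of_card_fiber_le S i hw hm fun j =>
    hmult V r P B hr hPB hmin (y j) _ ((Finset.filter_subset _ _).trans hSP) fun F hF => by
      obtain ⟨hFS, rfl⟩ := Finset.mem_filter.1 hF
      obtain ⟨p, hp, hpy⟩ := hnear F hFS
      exact ⟨hS F hFS, p, hp, hpy.trans (by nlinarith)⟩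
  have := mul_le_mul_of_nonneg_left hsum (by positivity : 0 ≤ 3 * C)
  rw [← Finset.mul_sum]
  linarith

/-- Iterating over dyadic scales. -/
lemma exists_fine_config (K : ℝ) (hK : 0 ≤ K) :
    ∃ C : ℝ, 0 ≤ C ∧ ∀ (V : Finset H) {ι : ℤ → Type*} (y : ∀ k, ι k → H)
      (w : ∀ k, ι k → ℝ≥0∞), ∑' k, ∑' i, w k i ≠ ⊤ →
      (∀ k, ∀ F ⊆ V, 0 < diam (F : Set H) → diam (F : Set H) ≤ (2 : ℝ) ^ (-k) →
        ∃ i, (∃ p ∈ F, dist p (y k i) ≤ K * (2 : ℝ) ^ (-k)) ∧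
          ∃ h, 0 ≤ h ∧ ENNReal.ofReal (h ^ 2 / (2 : ℝ) ^ (-k)) ≤ w k i ∧
            ∀ h' > h, NearLine F h') →
      ∀ r > 0, ∃ P B, IsConfig V r P B ∧
        configCost P B ≤ diam (V : Set H) + C * (∑' k, ∑' i, w k i).toReal := by
  obtain ⟨C, hC, hfiner⟩ := exists_finer_config H K hK
  refine ⟨2 * C, by positivity, fun V ι y w hw hflat r hr => ?_⟩
  have hw' (k) : ∑' i, w k i ≠ ⊤ := ENNReal.ne_top_of_tsum_ne_top hw k
  have half (k : ℤ) (c : ℝ)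
      (h : ∃ P B, IsConfig V ((2 : ℝ) ^ (-k)) P B ∧ configCost P B ≤ c) :
      ∃ P B, IsConfig V ((2 : ℝ) ^ (-(k + 1))) P B ∧
        configCost P B ≤ c + 2 * C * (∑' i, w k i).toReal := by
    have hs : 0 < (2 : ℝ) ^ (-k) := by positivity
    have h₁ := hfiner V _ _ c hs hs (by linarith) h (y k) (w k) (hw' k) (hflat k)
    obtain ⟨P, B, hPB, hcost⟩ := hfiner V _ ((2 : ℝ) ^ (-k)) _ (by positivity) hs (by linarith) h₁
      (y k) (w k) (hw' k) fun F hF hd hdr => hflat k F hF hd (hdr.trans (by linarith))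
    refine ⟨P, B, ⟨hPB.piece_subset, hPB.bridge_subset, fun F hF => (hPB.diam_le F hF).trans ?_,
      hPB.connects⟩, hcost.trans_eq (by ring)⟩
    rw [neg_add, zpow_add₀ two_ne_zero, zpow_neg_one]
    linarith
  obtain ⟨n₀, hn₀⟩ := pow_unbounded_of_one_lt (diam (V : Set H)) one_lt_two
  have iter (n : ℕ) : ∃ P B, IsConfig V ((2 : ℝ) ^ (-(n - n₀ : ℤ))) P B ∧
      configCost P B ≤ diam (V : Set H) +
        2 * C * ∑ j ∈ Finset.range n, (∑' i, w (j - n₀ : ℤ) i).toReal := by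
    induction n with
    | zero =>
      refine ⟨{V}, ∅, ⟨by simp, by simp, ?_, ?_⟩, by simp [configCost]⟩
      · simpa using hn₀.le
      · exact fun x hx x' hx' => .rel _ _ (.inl ⟨V, by simp, hx, hx'⟩)
    | succ n ih =>
      have := half _ _ ih
      rwa [Finset.sum_range_succ, mul_add, ← add_assoc,
        show ((n + 1 : ℕ) - n₀ : ℤ) = n - n₀ + 1 by push_cast; ring]
  obtain ⟨n, hn⟩ := pow_unbounded_of_one_lt ((2 : ℝ) ^ n₀ / r) one_lt_two
  obtain ⟨P, B, hPB, hcost⟩ := iter n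
  refine ⟨P, B, ⟨hPB.piece_subset, hPB.bridge_subset, fun F hF => (hPB.diam_le F hF).trans ?_,
    hPB.connects⟩, hcost.trans ?_⟩
  · rw [neg_sub, zpow_sub₀ two_ne_zero, zpow_natCast, zpow_natCast, div_le_iff₀ (by positivity)]
    rw [div_lt_iff₀ hr] at hn
    linarith
  · gcongr
    rw [← ENNReal.toReal_sum fun j _ => hw' _]
    gcongr
    have hinj : Function.Injective fun j : ℕ => (j - n₀ : ℤ) := fun a b h => by
      simpa using h
    exact (ENNReal.sum_le_tsum _).trans
      (ENNReal.tsum_comp_le_tsum_of_injective hinj fun k => ∑' i, w k i)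

end MultiscaleConfigurations

section Trails

variable {M : Type u} [MetricSpace M]

/-- A set of time-stamped points, visited at unit speed within the time span `[0, ℓ]`. -/
def IsTrail (T : Set (ℝ × M)) (ℓ : ℝ) : Prop :=
  ∀ a ∈ T, (0 ≤ a.1 ∧ a.1 ≤ ℓ) ∧ ∀ b ∈ T, dist a.2 b.2 ≤ |a.1 - b.1|

lemma IsTrail.mono {T : Set (ℝ × M)} {ℓ ℓ' : ℝ} (hT : IsTrail T ℓ) (h : ℓ ≤ ℓ') : IsTrail T ℓ' :=
  fun a ha => ⟨⟨(hT a ha).1.1, (hT a ha).1.2.trans h⟩, (hT a ha).2⟩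

/-- A detour from `u` to `v` and back. -/
lemma IsTrail.splice {T : Set (ℝ × M)} {ℓ : ℝ} (hT : IsTrail T ℓ) {u : M}
    (hu : u ∈ Prod.snd '' T) (v : M) :
    ∃ T', IsTrail T' (ℓ + 2 * dist u v) ∧ Prod.snd '' T ⊆ Prod.snd '' T' ∧ v ∈ Prod.snd '' T' := by
  obtain ⟨⟨s, u⟩, hsu, rfl⟩ := hu
  simp only
  set δ := dist u v with hδ
  have hδ0 : 0 ≤ δ := dist_nonneg
  let T' : Set (ℝ × M) :=
    {a | (a ∈ T ∧ a.1 ≤ s) ∨ (a = (s + δ, v)) ∨ ((a.1 - 2 * δ, a.2) ∈ T ∧ s ≤ a.1 - 2 * δ)}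
  have hord : ∀ a ∈ T', ∀ b ∈ T', a.1 ≤ b.1 → dist a.2 b.2 ≤ b.1 - a.1 := by
    have hle {p q : ℝ × M} (hp : p ∈ T) (hq : q ∈ T) (hpq : p.1 ≤ q.1) :
        dist p.2 q.2 ≤ q.1 - p.1 := by
      have := (hT p hp).2 q hq
      rwa [abs_of_nonpos (by linarith), neg_sub] at this
    rintro a (⟨ha, has⟩ | rfl | ⟨ha, has⟩) b (⟨hb, hbs⟩ | rfl | ⟨hb, hbs⟩) hab
    · exact hle ha hb hab
    · have h₁ := hle ha hsu has
      have h₂ := dist_triangle a.2 u v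
      simp only at h₁ ⊢
      linarith
    · have h₁ := hle ha hb (by simp only; linarith)
      simp only at h₁
      linarith
    · have h₁ := hle hb hsu hbs
      have h₂ := dist_triangle_left v b.2 u
      rw [dist_comm] at h₁
      simp only at h₁ hab ⊢
      linarith
    · simp
    · have h₁ := hle hsu hb hbs
      have h₂ := dist_triangle_left v b.2 u
      simp only at h₁ ⊢
      linarith
    · have h₁ := hle hb ha (by simp only; linarith)
      rw [dist_comm] at h₁
      simp only at h₁
      linarith
    · have h₁ := hle hsu ha has
      have h₂ := dist_triangle_left a.2 v u
      simp only at h₁ hab ⊢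
      linarith
    · have h₁ := hle ha hb (by simp only; linarith)
      simp only at h₁
      linarith
  refine ⟨T', fun a ha => ⟨?_, fun b hb => ?_⟩, ?_, ?_⟩
  · have hs := (hT _ hsu).1
    simp only at hs
    rcases ha with ⟨ha, has⟩ | rfl | ⟨ha, has⟩
    · have := (hT _ ha).1
      exact ⟨this.1, by linarith⟩
    · exact ⟨by simp only; linarith, by simp only; linarith⟩
    · have := (hT _ ha).1
      simp only at this
      exact ⟨by linarith, by linarith⟩
  · rcases le_total a.1 b.1 with hab | hab
    · rw [abs_of_nonpos (by linarith), neg_sub]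
      exact hord a ha b hb hab
    · rw [abs_of_nonneg (by linarith), dist_comm]
      exact hord b hb a ha hab
  · rintro _ ⟨a, ha, rfl⟩
    rcases le_total a.1 s with h | h
    · exact ⟨a, .inl ⟨ha, h⟩, rfl⟩
    · exact ⟨(a.1 + 2 * δ, a.2), .inr (.inr ⟨by simpa using ha, by simpa using h⟩), rfl⟩
  · exact ⟨_, .inr (.inl rfl), rfl⟩

/-- A finite connected graph can be traversed in twice its length. -/
lemma exists_trail (B : Finset (M × M)) (x₀ : M) :
    ∃ T, IsTrail T (2 * ∑ b ∈ B, dist b.1 b.2) ∧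
      ∀ y, Linked ∅ B x₀ y → y ∈ Prod.snd '' T := by
  let S := B.powerset.filter fun B' => ∃ T, IsTrail T (2 * ∑ b ∈ B', dist b.1 b.2) ∧
    x₀ ∈ Prod.snd '' T ∧ ∀ b ∈ B', b.1 ∈ Prod.snd '' T ∧ b.2 ∈ Prod.snd '' T
  obtain ⟨B', hB', hmax⟩ := S.exists_max_image Finset.card
    ⟨∅, Finset.mem_filter.2 ⟨by simp, {(0, x₀)}, by simp [IsTrail], by simp, by simp⟩⟩
  obtain ⟨hB'B, T, hT, hx₀, hcov⟩ := Finset.mem_filter.1 hB'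
  rw [Finset.mem_powerset] at hB'B
  have hdetour (b) (hb : b ∈ B) (u v : M) (huv : dist u v = dist b.1 b.2)
      (hsub : ∀ A : Set M, u ∈ A → v ∈ A → b.1 ∈ A ∧ b.2 ∈ A) (hu : u ∈ Prod.snd '' T) :
      b ∈ B' := by
    by_contra hbB'
    obtain ⟨T', hT', hTT', hv⟩ := hT.splice hu v
    have hmem : insert b B' ∈ S := by
      refine Finset.mem_filter.2 ⟨Finset.mem_powerset.2 (Finset.insert_subset hb hB'B), T', ?_,
        hTT' hx₀, fun a ha => ?_⟩
      · rw [Finset.sum_insert hbB', ← huv, mul_add, add_comm]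
        exact hT'
      · rcases Finset.mem_insert.1 ha with rfl | ha
        · exact hsub _ (hTT' hu) hv
        · exact (hcov a ha).imp (fun h => hTT' h) fun h => hTT' h
    have := hmax _ hmem
    rw [Finset.card_insert_of_notMem hbB'] at this
    omega
  have hclosed (x y : M) (h : Linked ∅ B x y) : x ∈ Prod.snd '' T ↔ y ∈ Prod.snd '' T := by
    induction h with
    | rel x y h =>
      have hb : (x, y) ∈ B := by simpa using h
      exact ⟨fun h => (hcov _ (hdetour _ hb x y rfl (fun _ h h' => ⟨h, h'⟩) h)).2,
        fun h => (hcov _ (hdetour _ hb y x (dist_comm _ _) (fun _ h h' => ⟨h', h⟩) h)).1⟩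
    | refl x => exact .rfl
    | symm x y _ ih => exact ih.symm
    | trans x y z _ _ ih₁ ih₂ => exact ih₁.trans ih₂
  have hsum : ∑ b ∈ B', dist b.1 b.2 ≤ ∑ b ∈ B, dist b.1 b.2 :=
    Finset.sum_le_sum_of_subset_of_nonneg hB'B fun _ _ _ => dist_nonneg
  exact ⟨T, hT.mono (by linarith), fun y hy => (hclosed _ _ hy).1 hx₀⟩

/-- In a normed space, a trail lies on a Lipschitz curve parametrized by the unit interval. -/
lemma IsTrail.exists_lipschitz {X : Type u} [NormedAddCommGroup X] [NormedSpace ℝ X]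
    [FiniteDimensional ℝ X] {T : Set (ℝ × X)} {ℓ : ℝ≥0} (hT : IsTrail T ℓ) :
    ∃ g : ℝ → X, LipschitzWith (lipschitzExtensionConstant X * ℓ) g ∧
      Prod.snd '' T ⊆ g '' Icc 0 1 := by
  have hex (t) (ht : t ∈ Prod.fst '' T) : ∃ p, (t, p) ∈ T := by
    obtain ⟨a, ha, rfl⟩ := ht
    exact ⟨a.2, ha⟩
  choose! f hf using hex
  have hlip : LipschitzOnWith 1 f (Prod.fst '' T) := .of_dist_le_mul fun s hs t ht => by
    simpa [Real.dist_eq] using (hT _ (hf s hs)).2 _ (hf t ht)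
  obtain ⟨g, hg, hfg⟩ := hlip.extend_finite_dimension
  have hscale : LipschitzWith ℓ fun s : ℝ => (ℓ : ℝ) * s := .of_dist_le_mul fun s t => by
    rw [Real.dist_eq, Real.dist_eq, ← mul_sub, abs_mul, NNReal.abs_eq]
  refine ⟨g ∘ fun s => ℓ * s, by simpa using hg.comp hscale, ?_⟩
  rintro _ ⟨a, ha, rfl⟩
  have hat : a.1 ∈ Prod.fst '' T := ⟨a, ha, rfl⟩
  have hga : g a.1 = a.2 := by
    rw [← hfg hat, ← dist_le_zero]
    simpa using (hT _ (hf _ hat)).2 a ha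
  obtain ⟨h₀, h₁⟩ := (hT a ha).1
  rcases ℓ.coe_nonneg.eq_or_lt with hℓ | hℓ
  · exact ⟨0, by simp, by
      rw [← hga, Function.comp_apply, mul_zero]
      congr 1
      linarith⟩
  · exact ⟨a.1 / ℓ, ⟨by positivity, (div_le_one hℓ).2 h₁⟩, by
      rw [Function.comp_apply, mul_div_cancel₀ _ hℓ.ne', hga]⟩

end Trails

section Limits

open Filter Topology in
/-- A limit of Lipschitz curves that come close to all points of `E` covers `E`. -/
lemma exists_lipschitz_cover_of_tendsto {X : Type u} [MetricSpace X] [ProperSpace X] {E : Set X}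
    (hE : E.Nonempty) {K : ℝ≥0} {g : ℕ → ℝ → X} (hg : ∀ n, LipschitzWith K (g n))
    (hcov : ∀ e ∈ E, ∃ t : ℕ → ℝ, (∀ n, t n ∈ Icc (0 : ℝ) 1) ∧
      Tendsto (fun n => g n (t n)) atTop (𝓝 e)) :
    ∃ f : ℝ → X, LipschitzWith K f ∧ E ⊆ f '' Icc 0 1 := by
  let U : Ultrafilter ℕ := hyperfilter ℕ
  have hU : (U : Filter ℕ) ≤ atTop := Nat.hyperfilter_le_atTop
  obtain ⟨e₀, he₀⟩ := hE
  have hlim (s : ℝ) : ∃ x, Tendsto (fun n => g n s) U (𝓝 x) := by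
    obtain ⟨t, ht, hte⟩ := hcov e₀ he₀
    have hball : ∀ᶠ n in atTop, g n s ∈ closedBall e₀ (K * (|s| + 1) + 1) := by
      filter_upwards [hte.eventually (ball_mem_nhds e₀ one_pos)] with n hn
      have h₁ : dist s (t n) ≤ |s| + 1 := by
        rw [Real.dist_eq]
        have := abs_sub s (t n)
        rw [abs_of_nonneg (ht n).1] at this
        linarith [(ht n).2]
      have h₂ : dist (g n s) (g n (t n)) ≤ K * (|s| + 1) :=
        ((hg n).dist_le_mul _ _).trans (by gcongr)
      have h₃ := dist_triangle (g n s) (g n (t n)) e₀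
      rw [mem_closedBall]
      linarith [mem_ball.1 hn]
    obtain ⟨x, -, hx⟩ := (isCompact_closedBall e₀ (K * (|s| + 1) + 1)).ultrafilter_le_nhds
      (U.map fun n => g n s) (le_principal_iff.2 (hU hball))
    exact ⟨x, hx⟩
  choose f hf using hlim
  refine ⟨f, .of_dist_le_mul fun s t => ?_, fun e he => ?_⟩
  · exact le_of_tendsto ((hf s).dist (hf t)) (.of_forall fun n => (hg n).dist_le_mul s t)
  · obtain ⟨t, ht, hte⟩ := hcov e he
    obtain ⟨s, hs, hts⟩ := isCompact_Icc.ultrafilter_le_nhds (U.map t)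
      (le_principal_iff.2 (Filter.mem_map.2 (Filter.univ_mem' ht)))
    have hts : Tendsto t U (𝓝 s) := hts
    refine ⟨s, hs, tendsto_nhds_unique (hf s) ?_⟩
    have h₀ : Tendsto (fun n => (K : ℝ) * dist s (t n)) U (𝓝 0) := by
      simpa using ((tendsto_const_nhds (x := s)).dist hts).const_mul (K : ℝ)
    refine (tendsto_iff_of_dist (squeeze_zero (fun _ => dist_nonneg)
      (fun n => (hg n).dist_le_mul s (t n)) h₀)).2 (hte.mono_left hU)

end Limits

section Main

/-- A configuration of small mesh consists of bridges only. -/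
lemma exists_trail_of_fine_configs {M : Type u} [MetricSpace M] {V : Finset M} {c : ℝ}
    (h : ∀ r > 0, ∃ P B, IsConfig V r P B ∧ configCost P B ≤ c) :
    ∃ T : Set (ℝ × M), IsTrail T (4 * c) ∧ (V : Set M) ⊆ Prod.snd '' T := by
  obtain ⟨r, hr, hsep⟩ : ∃ r > 0, ∀ x ∈ V, ∀ y ∈ V, dist x y ≤ r → x = y := by
    rcases V.offDiag.eq_empty_or_nonempty with he | hne
    · refine ⟨1, one_pos, fun x hx y hy _ => ?_⟩
      by_contra hxy
      have : (x, y) ∈ V.offDiag := Finset.mem_offDiag.2 ⟨hx, hy, hxy⟩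
      simp [he] at this
    · obtain ⟨a, ha, hmin⟩ := V.offDiag.exists_min_image (fun a => dist a.1 a.2) hne
      have hpos : 0 < dist a.1 a.2 := dist_pos.2 (Finset.mem_offDiag.1 ha).2.2
      refine ⟨dist a.1 a.2 / 2, by positivity, fun x hx y hy hxy => ?_⟩
      by_contra hne
      have := hmin (x, y) (Finset.mem_offDiag.2 ⟨hx, hy, hne⟩)
      simp only at this
      linarith
  obtain ⟨P, B, hPB, hcost⟩ := h r hr
  have hlen : 2 * ∑ b ∈ B, dist b.1 b.2 ≤ 4 * c := by
    have : 0 ≤ ∑ F ∈ P, diam (F : Set M) := Finset.sum_nonneg fun _ _ => diam_nonneg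
    simp only [configCost] at hcost
    linarith
  rcases V.eq_empty_or_nonempty with rfl | ⟨x₀, hx₀⟩
  · exact ⟨∅, by simp [IsTrail], by simp⟩
  obtain ⟨T, hT, hcov⟩ := exists_trail B x₀
  refine ⟨T, hT.mono hlen, fun y hy => hcov y ?_⟩
  refine (hPB.connects x₀ hx₀ y hy).of_imp (fun F hF x hx x' hx' => ?_)
    fun b hb => .rel _ _ (.inr hb)
  have := hsep x (hPB.piece_subset F hF hx) x' (hPB.piece_subset F hF hx')
    ((dist_le_diam_of_finset hx hx').trans (hPB.diam_le F hF))
  exact this ▸ .refl x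

variable {X : Type u} [NormedAddCommGroup X] [NormedSpace ℝ X]

lemma jonesBeta_nonneg (E Q : Set X) : 0 ≤ jonesBeta E Q := by
  rw [jonesBeta]
  split_ifs
  · exact le_rfl
  · refine Real.sInf_nonneg ?_
    rintro _ ⟨a, v, -, rfl⟩
    refine Real.sSup_nonneg ?_
    rintro _ ⟨x, -, rfl⟩
    exact div_nonneg infDist_nonneg diam_nonneg

lemma exists_line_of_jonesBeta_lt {E Q : Set X} (hQ : IsBounded Q) (hd : 0 < diam Q) {b : ℝ}
    (hne : (E ∩ Q).Nonempty) (h : jonesBeta E Q < b) :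
    ∃ a v : X, v ≠ 0 ∧ ∀ x ∈ E ∩ Q, ∃ y ∈ lineThrough a v, dist x y < b * diam Q := by
  rw [jonesBeta, if_neg hne.ne_empty] at h
  have : Nontrivial X := by
    by_contra hX
    rw [not_nontrivial_iff_subsingleton] at hX
    exact hd.ne' (diam_subsingleton Set.subsingleton_of_subsingleton)
  obtain ⟨v₀, hv₀⟩ := exists_ne (0 : X)
  obtain ⟨_, ⟨a, v, hv, rfl⟩, hlt⟩ := exists_lt_of_csInf_lt (by exact ⟨_, 0, v₀, hv₀, rfl⟩) h
  have ha : a ∈ lineThrough a v := ⟨0, by simp⟩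
  refine ⟨a, v, hv, fun x hx => ?_⟩
  rw [← infDist_lt_iff ⟨a, ha⟩, ← div_lt_iff₀ hd]
  refine (le_csSup ?_ (mem_image_of_mem _ hx)).trans_lt hlt
  obtain ⟨R, hR⟩ := hQ.subset_closedBall a
  refine ⟨R / diam Q, ?_⟩
  rintro _ ⟨z, hz, rfl⟩
  have := (infDist_le_dist_of_mem ha).trans (mem_closedBall.1 (hR hz.2))
  simp only
  gcongr

variable (X) in
/-- A finite-dimensional space embeds linearly and bi-Lipschitzly into a Euclidean space. -/
lemma exists_expanding_linear_map [FiniteDimensional ℝ X] :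
    ∃ (φ : X →L[ℝ] EuclideanSpace ℝ (Fin (Module.finrank ℝ X))) (K : ℝ), 0 < K ∧
      ∀ x y, dist x y ≤ dist (φ x) (φ y) ∧ dist (φ x) (φ y) ≤ K * dist x y := by
  let ψ := toEuclidean (E := X)
  let c : ℝ := ‖(ψ.symm : EuclideanSpace ℝ (Fin (Module.finrank ℝ X)) →L[ℝ] X)‖
  have hc : 0 ≤ c := norm_nonneg _
  let φ := (c + 1) • (ψ : X →L[ℝ] EuclideanSpace ℝ (Fin (Module.finrank ℝ X)))
  refine ⟨φ, ‖φ‖ + 1, by positivity, fun x y => ?_⟩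
  rw [dist_eq_norm, dist_eq_norm, ← map_sub]
  refine ⟨?_, (φ.le_opNorm _).trans (by gcongr; linarith)⟩
  have h₁ : ‖x - y‖ ≤ c * ‖ψ (x - y)‖ := by
    simpa using
      (ψ.symm : EuclideanSpace ℝ (Fin (Module.finrank ℝ X)) →L[ℝ] X).le_opNorm (ψ (x - y))
  have h₂ : ‖φ (x - y)‖ = (c + 1) * ‖ψ (x - y)‖ := by
    simp only [φ, smul_apply, norm_smul]
    rw [Real.norm_of_nonneg (by positivity)]
    rfl
  rw [h₂]
  linarith [norm_nonneg (ψ (x - y))]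

/-- The bridge between Jones beta numbers and flatness of finite sets in a Euclidean image. -/
lemma exists_nearLine_of_net {H : Type*} [NormedAddCommGroup H] [InnerProductSpace ℝ H]
    {φ : X →L[ℝ] H} {K : ℝ} (hK : 0 < K)
    (hφ : ∀ x y, dist x y ≤ dist (φ x) (φ y) ∧ dist (φ x) (φ y) ≤ K * dist x y)
    {A r : ℝ} (hA : 2 ≤ A) (hr : 0 < r) {E S : Set X} (hS : ∀ e ∈ E, ∃ x ∈ S, dist e x ≤ r)
    {V : Finset X} (hV : (V : Set X) ⊆ E) {F : Finset H} (hF : F ⊆ V.image φ)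
    (hpos : 0 < diam (F : Set H)) (hFr : diam (F : Set H) ≤ r) :
    ∃ x : S, (∃ p ∈ F, dist p (φ x) ≤ K * r) ∧ ∃ h, 0 ≤ h ∧
      ENNReal.ofReal (h ^ 2 / r) ≤ ENNReal.ofReal (2 * A * K ^ 2) *
        ENNReal.ofReal (jonesBeta E (closedBall (x : X) (A * r)) ^ (2 : ℝ) *
          diam (closedBall (x : X) (A * r))) ∧
      ∀ h' > h, NearLine F h' := by
  have hsub : (F : Set H).Nontrivial := by
    by_contra hF'
    exact hpos.ne' (diam_subsingleton (not_nontrivial_iff.1 hF'))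
  obtain ⟨p, hp, q, hq, hpq⟩ := hsub
  have hV' (z) (hz : z ∈ F) : ∃ e ∈ E, φ e = z := by
    obtain ⟨e, he, hez⟩ := Finset.mem_image.1 (hF hz)
    exact ⟨e, hV he, hez⟩
  obtain ⟨e, he, rfl⟩ := hV' p hp
  obtain ⟨e', he', rfl⟩ := hV' q hq
  obtain ⟨x, hx, hex⟩ := hS e he
  set Q := closedBall x (A * r) with hQ
  have hQF (z) (hz : φ z ∈ F) : z ∈ Q := by
    have h₁ := (hφ z e).1.trans ((dist_le_diam_of_finset hz hp).trans hFr)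
    have h₂ := dist_triangle z e x
    rw [hQ, mem_closedBall]
    nlinarith
  have hd : 0 < diam Q := by
    exact (dist_pos.2 fun h => hpq (congrArg φ h)).trans_le
      (dist_le_diam_of_mem isBounded_closedBall (hQF e hp) (hQF e' hq))
  have hd' : diam Q ≤ 2 * (A * r) := diam_closedBall (by positivity)
  have hβ := jonesBeta_nonneg E Q
  refine ⟨⟨x, hx⟩, ⟨φ e, hp, (hφ e x).2.trans (by gcongr)⟩, K * jonesBeta E Q * diam Q,
    by positivity, ?_, fun h' hh' => ?_⟩
  · rw [← ENNReal.ofReal_mul (by positivity), Real.rpow_two]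
    refine ENNReal.ofReal_le_ofReal ((div_le_iff₀ hr).2 ?_)
    calc (K * jonesBeta E Q * diam Q) ^ 2
        = K ^ 2 * jonesBeta E Q ^ 2 * diam Q * diam Q := by ring
      _ ≤ K ^ 2 * jonesBeta E Q ^ 2 * diam Q * (2 * (A * r)) := by gcongr
      _ = 2 * A * K ^ 2 * (jonesBeta E Q ^ 2 * diam Q) * r := by ring
  · have hlt : jonesBeta E Q < h' / (K * diam Q) := by
      rw [lt_div_iff₀ (by positivity)]
      linarith
    obtain ⟨a, v, hv, hline⟩ :=
      exists_line_of_jonesBeta_lt isBounded_closedBall hd ⟨e, he, hQF e hp⟩ hlt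
    refine ⟨φ a, φ v, fun h0 => hv ?_, fun z hz => ?_⟩
    · have := (hφ v 0).1
      rwa [h0, map_zero, dist_self, dist_le_zero] at this
    · obtain ⟨c, hc, rfl⟩ := hV' z hz
      obtain ⟨_, ⟨t, rfl⟩, hy⟩ := hline c ⟨hc, hQF c hz⟩
      refine ⟨φ (a + t • v), ⟨t, by simp⟩, (hφ _ _).2.trans ?_⟩
      calc K * dist c (a + t • v) ≤ K * (h' / (K * diam Q) * diam Q) := by gcongr
        _ = h' := by field_simp

/-- Finite subsets of `E` can be traversed efficiently. -/
lemma exists_trail_of_betaSum {H : Type*} [NormedAddCommGroup H] [InnerProductSpace ℝ H]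
    [FiniteDimensional ℝ H] {φ : X →L[ℝ] H} {K : ℝ} (hK : 0 < K)
    (hφ : ∀ x y, dist x y ≤ dist (φ x) (φ y) ∧ dist (φ x) (φ y) ≤ K * dist x y)
    {A : ℝ} (hA : 2 ≤ A) :
    ∃ C : ℝ, 0 ≤ C ∧ ∀ (E : Set X) (net : ℤ → Set X), IsBounded E → IsMultiresolution E net →
      betaSum E net A 2 ≠ ⊤ → ∀ V : Finset X, (V : Set X) ⊆ E →
        ∃ T : Set (ℝ × X), IsTrail T (C * (diam E + (betaSum E net A 2).toReal)) ∧
          (V : Set X) ⊆ Prod.snd '' T := by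
  obtain ⟨C, hC, hconfig⟩ := exists_fine_config H K hK.le
  refine ⟨4 * (K + C * (2 * A * K ^ 2)), by positivity, fun E net hE hnet hβ V hV => ?_⟩
  let w (k : ℤ) (x : net k) : ℝ≥0∞ := ENNReal.ofReal (2 * A * K ^ 2) *
    ENNReal.ofReal (jonesBeta E (closedBall (x : X) (A * (2 : ℝ) ^ (-k))) ^ (2 : ℝ) *
      diam (closedBall (x : X) (A * (2 : ℝ) ^ (-k))))
  have hw : ∑' k, ∑' x, w k x = ENNReal.ofReal (2 * A * K ^ 2) * betaSum E net A 2 := by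
    simp only [w, ENNReal.tsum_mul_left, betaSum]
  have hfine := hconfig (V.image φ) (fun k (x : net k) => φ x) w
    (by rw [hw]; exact ENNReal.mul_ne_top ENNReal.ofReal_ne_top hβ)
    fun k F hF hpos hFr =>
      exists_nearLine_of_net hK hφ hA (by positivity) (hnet.2 k) hV hF hpos hFr
  rw [hw, ENNReal.toReal_mul, ENNReal.toReal_ofReal (by positivity)] at hfine
  obtain ⟨T, hT, hVT⟩ := exists_trail_of_fine_configs hfine
  have hdiam : diam ((V.image φ : Finset H) : Set H) ≤ K * diam E := by
    refine diam_le_of_finset (by positivity) fun p hp q hq => ?_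
    obtain ⟨x, hx, rfl⟩ := Finset.mem_image.1 hp
    obtain ⟨y, hy, rfl⟩ := Finset.mem_image.1 hq
    exact (hφ x y).2.trans (by gcongr; exact dist_le_diam_of_mem hE (hV hx) (hV hy))
  refine ⟨{a | (a.1, φ a.2) ∈ T}, fun a ha => ⟨⟨(hT _ ha).1.1, (hT _ ha).1.2.trans ?_⟩,
    fun b hb => (hφ _ _).1.trans ((hT _ ha).2 _ hb)⟩, fun x hx => ?_⟩
  · have h₁ : 0 ≤ C * (2 * A * K ^ 2) * diam E := by positivity
    have h₂ : 0 ≤ K * (betaSum E net A 2).toReal := by positivity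
    linarith
  · obtain ⟨⟨t, p⟩, ht, hp⟩ := hVT (Finset.mem_image_of_mem φ hx)
    simp only at hp
    exact ⟨(t, x), by simpa [hp] using ht, rfl⟩

/-- A bounded separated set in a finite-dimensional space is finite. -/
lemma finite_of_separated [FiniteDimensional ℝ X] {S : Set X} (hS : IsBounded S) {δ : ℝ}
    (hδ : 0 < δ) (hsep : ∀ x ∈ S, ∀ y ∈ S, x ≠ y → δ ≤ dist x y) : S.Finite := by
  obtain ⟨D, hD⟩ := hS.subset_closedBall 0
  obtain ⟨N, hN⟩ := exists_packing_bound X (D / (δ / 2))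
  by_contra hinf
  obtain ⟨s, hs, hcard⟩ := Set.Infinite.exists_subset_card_eq hinf (N + 1)
  have := hN s 0 (δ / 2) (by positivity)
    (fun x hx => by rw [div_mul_cancel₀ _ (by positivity)]; exact mem_closedBall.1 (hD (hs hx)))
    fun x hx x' hx' hne => (half_lt_self hδ).trans_le (hsep x (hs hx) x' (hs hx') hne)
  omega

end Main
/-- Theorem 1.1(iv): sufficient condition in a finite-dimensional normed space, with
exponent `p = 2`; the constant may depend on the space. -/
theorem statement3 (X : Type u) [NormedAddCommGroup X] [NormedSpace ℝ X]
    [FiniteDimensional ℝ X] [MeasurableSpace X] [BorelSpace X] (A : ℝ) (hA : 240 ≤ A) :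
    ∃ C : ℝ, 0 < C ∧
      ∀ (E : Set X) (net : ℤ → Set X),
        E.Nonempty → IsBounded E → IsMultiresolution E net → SEp E net A 2 < ⊤ →
        ∃ Γ : Set X, E ⊆ Γ ∧ IsRectifiableCurve Γ ∧
          μH[1] Γ ≤ ENNReal.ofReal C * SEp E net A 2 := by
  obtain ⟨φ, K, hK, hφ⟩ := exists_expanding_linear_map X
  obtain ⟨C₀, hC₀, htrail⟩ := exists_trail_of_betaSum hK hφ (A := A) (by linarith)
  refine ⟨lipschitzExtensionConstant X * C₀ + 1, by positivity,
    fun E net hne hE hnet hfin => ?_⟩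
  have hβ : betaSum E net A 2 ≠ ⊤ := (ENNReal.add_lt_top.1 hfin).2.ne
  have hS : (SEp E net A 2).toReal = diam E + (betaSum E net A 2).toReal := by
    rw [SEp, ENNReal.toReal_add ENNReal.ofReal_ne_top hβ, ENNReal.toReal_ofReal diam_nonneg]
  obtain ⟨⟨hsub, -, hsep⟩, hnear⟩ := id hnet
  have hnetfin (n : ℕ) : (net n).Finite :=
    finite_of_separated (hE.subset (hsub n)) (by positivity) (hsep n)
  let ℓ : ℝ≥0 := ⟨C₀ * (SEp E net A 2).toReal, by positivity⟩
  have hcurve (n : ℕ) : ∃ g : ℝ → X, LipschitzWith (lipschitzExtensionConstant X * ℓ) g ∧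
      net n ⊆ g '' Icc 0 1 := by
    obtain ⟨T, hT, hVT⟩ := htrail E net hE hnet hβ (hnetfin n).toFinset
      (by simpa using hsub n)
    rw [← hS] at hT
    obtain ⟨g, hg, hTg⟩ := IsTrail.exists_lipschitz (ℓ := ℓ) hT
    exact ⟨g, hg, (by simpa using hVT : net n ⊆ _).trans hTg⟩
  choose g hg hcov using hcurve
  have : ProperSpace X := FiniteDimensional.proper ℝ X
  obtain ⟨f, hf, hEf⟩ := exists_lipschitz_cover_of_tendsto hne hg fun e he => by
    choose x hx hex using fun n : ℕ => hnear n e he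
    choose t ht htx using fun n => hcov n (hx n)
    refine ⟨t, ht, tendsto_iff_dist_tendsto_zero.2 ?_⟩
    refine squeeze_zero (fun _ => dist_nonneg) (fun n => ?_)
      (tendsto_pow_atTop_nhds_zero_of_lt_one (r := (1 / 2 : ℝ)) (by norm_num) (by norm_num))
    rw [htx, dist_comm]
    simpa using hex n
  have hmeas : μH[1] (f '' Icc 0 1) ≤
      ENNReal.ofReal (lipschitzExtensionConstant X * C₀ + 1) * SEp E net A 2 := by
    refine (hf.hausdorffMeasure_image_le zero_le_one _).trans ?_
    rw [hausdorffMeasure_real, Real.volume_Icc, sub_zero, ENNReal.ofReal_one, mul_one,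
      ENNReal.rpow_one, ← ENNReal.ofReal_toReal hfin.ne, ← ENNReal.ofReal_mul (by positivity),
      ← ENNReal.ofReal_coe_nnreal]
    refine ENNReal.ofReal_le_ofReal ?_
    have h₀ : 0 ≤ (SEp E net A 2).toReal := ENNReal.toReal_nonneg
    have hℓ : (ℓ : ℝ) = C₀ * (SEp E net A 2).toReal := rfl
    push_cast
    rw [hℓ]
    linarith
  exact ⟨f '' Icc 0 1, hEf, ⟨⟨f, hf.continuous.continuousOn, rfl⟩,
    hmeas.trans_lt (ENNReal.mul_lt_top ENNReal.ofReal_lt_top hfin)⟩, hmeas⟩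

end
end
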